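/- Let n >= 2, let q be a prime power, and let 0 <= i <= n-2. Let pi be an n-dimensional projective subspace of PG(2n+1,q^2) such that pi_i := pi intersect pi^sigma has projective dimension i. Let P be a point of H(2n+1,q^2) lying neither on pi nor on pi^sigma, and suppose P does not lie on the projective span of pi and pi^sigma. Then the number of generators mu of H(2n+1,q^2) through P such that exactly one point of mu lies on pi but not on pi_i, and exactly one point of mu lies on pi^sigma but not on pi_i, equals N(n-1,i-1) * q^{4i} * (mu_{n-i-1}(q^2))^2. -/

import Mathlib

open scoped BigOperators

namespace HermCode

/-- The Hermitian sesquilinear form `h(x,y) = ∑ᵢ xᵢ * yᵢ^q` on `F^m`. -/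
def herm (q : ℕ) {F : Type} [Field F] {m : ℕ} (x y : Fin m → F) : F :=
  ∑ i, x i * (y i) ^ q

/-- For a fixed vector `x`, the linear map `y ↦ h(y,x)`. -/
def hermL (q : ℕ) {F : Type} [Field F] {m : ℕ} (x : Fin m → F) :
    (Fin m → F) →ₗ[F] F where
  toFun y := herm q y x
  map_add' a b := by
    simp [herm, add_mul, Finset.sum_add_distrib]
  map_smul' c a := by
    simp [herm, Finset.mul_sum, mul_assoc]

/-- The image `W^σ` of a subspace `W` under the Hermitian polarity `σ`:
the subspace of all vectors orthogonal to every vector of `W`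
with respect to the Hermitian form. -/
def polar (q : ℕ) {F : Type} [Field F] {m : ℕ} (W : Submodule F (Fin m → F)) :
    Submodule F (Fin m → F) :=
  ⨅ x : W, LinearMap.ker (hermL q (x : Fin m → F))

/-- A subspace all of whose points lie on the Hermitian variety. -/
def TotallyIsotropic (q : ℕ) {F : Type} [Field F] {m : ℕ}
    (W : Submodule F (Fin m → F)) : Prop :=
  ∀ x ∈ W, herm q x x = 0

/-- A point of the Hermitian variety: a projective point (1-dimensional subspace)
spanned by an isotropic vector. -/
def IsHermPoint (q : ℕ) {F : Type} [Field F] {m : ℕ}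
    (P : Submodule F (Fin m → F)) : Prop :=
  Module.finrank F P = 1 ∧ TotallyIsotropic q P

/-- A generator of `H(2n+1,q²)`: an `n`-dimensional projective subspace all of
whose points lie on the Hermitian variety. -/
def IsGenerator (q n : ℕ) {F : Type} [Field F]
    (W : Submodule F (Fin (2*n+2) → F)) : Prop :=
  Module.finrank F W = n + 1 ∧ TotallyIsotropic q W

/-- A code word of the dual code `C_n(H(2n+1,q²))^⊥`: a function from points to `F_p`
(vanishing off the Hermitian variety) summing to zero over every generator. -/
def IsCodeword (p q n : ℕ) {F : Type} [Field F]
    (c : Submodule F (Fin (2*n+2) → F) → ZMod p) : Prop :=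
  (∀ P, ¬ IsHermPoint q P → c P = 0) ∧
  ∀ μ, IsGenerator q n μ → (∑ᶠ P ∈ {P | IsHermPoint q P ∧ P ≤ μ}, c P) = 0

/-- The (Hamming) weight of a code word. -/
noncomputable def wt {p : ℕ} {α : Type*} (c : α → ZMod p) : ℕ :=
  Nat.card {x : α // c x ≠ 0}

open scoped Classical in
/-- The incidence vector `v_π` of `π ∩ H`. -/
noncomputable def vsub (p q : ℕ) {F : Type} [Field F] {m : ℕ}
    (π : Submodule F (Fin m → F)) : Submodule F (Fin m → F) → ZMod p :=
  fun P => if IsHermPoint q P ∧ P ≤ π then 1 else 0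

/-- `θ_m(q)`, the number of points of `PG(m,q)`. -/
noncomputable def theta (q : ℕ) (m : ℤ) : ℚ :=
  ((q:ℚ)^(m+1) - 1) / ((q:ℚ) - 1)

/-- `μ_m(q²)`, the number of points of `H(m,q²)` (with `μ_{-1} = 0`). -/
noncomputable def muH (q : ℕ) (m : ℤ) : ℚ :=
  (((q:ℚ)^(m+1) - (-1:ℚ)^(m+1)) * ((q:ℚ)^m - (-1:ℚ)^m)) / ((q:ℚ)^2 - 1)

/-- The number `N(n,i)`. -/
noncomputable def NN (q n : ℕ) (i : ℤ) : ℚ :=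
  (q:ℚ)^(((n:ℤ)-1)^2 - ((((n:ℤ)-i-1).toNat.choose 2 : ℕ) : ℤ)) *
    ∏ j ∈ Finset.range ((n:ℤ)-i-2).toNat, ((q:ℚ)^(j+1) - (-1:ℚ)^(j+1))

open scoped Classical in
/-- The quantity `Σ_{n,i}`. -/
noncomputable def SigmaNI (q n : ℕ) (i : ℤ) : ℚ :=
  if Odd ((n:ℤ) - i) then
    2*(q:ℚ)^(2*i+2) * muH q ((n:ℤ)-i-1)
      + 4 * muH q ((n:ℤ)-i-2) * ((q:ℚ)^((n:ℤ)-i-1) - 1)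
          / ((q:ℚ)^((n:ℤ)-3*i-5) * ((q:ℚ)^2 - 1))
  else
    2*(q:ℚ)^(2*i+2) * (muH q ((n:ℤ)-i-1)
      + 2*((q:ℚ)^(4:ℤ) * muH q ((n:ℤ)-i-3) + (q:ℚ)^2 - 1)/((q:ℚ)^2 - 1))

/-- `P` lies on a projective line entirely contained in the Hermitian variety that
meets both `π \ (π ⊓ π^σ)` and `π^σ \ (π ⊓ π^σ)`. -/
def OnGoodLine (q : ℕ) {F : Type} [Field F] {m : ℕ}
    (π P : Submodule F (Fin m → F)) : Prop :=
  ∃ A B : Submodule F (Fin m → F),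
    Module.finrank F A = 1 ∧ A ≤ π ∧ ¬ A ≤ π ⊓ polar q π ∧
    Module.finrank F B = 1 ∧ B ≤ polar q π ∧ ¬ B ≤ π ⊓ polar q π ∧
    P ≤ A ⊔ B ∧ TotallyIsotropic q (A ⊔ B)


set_option linter.unusedSectionVars false

/-- The facts on `F = F_{q^2}` that we use. -/
structure Good (q : ℕ) (F : Type) [Field F] [Fintype F] : Prop where
  card : Fintype.card F = q ^ 2
  add_pow : ∀ x y : F, (x + y) ^ q = x ^ q + y ^ q
  one_lt : 1 < q

section base
variable {q : ℕ} {F : Type} [Field F] [Fintype F] {m : ℕ}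

theorem Good.pow_pow (g : Good q F) (x : F) : (x ^ q) ^ q = x := by
  rw [← pow_mul, ← pow_two, ← g.card, FiniteField.pow_card]

theorem Good.natCard (g : Good q F) : Nat.card F = q ^ 2 := by
  rw [Nat.card_eq_fintype_card, g.card]

theorem Good.ne_zero (g : Good q F) : q ≠ 0 := by have := g.one_lt; omega

/-- Frobenius as a ring homomorphism. -/
def Good.frob (g : Good q F) : F →+* F where
  toFun x := x ^ q
  map_one' := one_pow q
  map_mul' x y := mul_pow x y q
  map_zero' := zero_pow g.ne_zero
  map_add' := g.add_pow

theorem Good.neg_pow (g : Good q F) (x : F) : (-x) ^ q = - x ^ q := map_neg g.frob x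

theorem herm_add_left (x y z : Fin m → F) : herm q (x + y) z = herm q x z + herm q y z :=
  (hermL q z).map_add x y

theorem herm_smul_left (a : F) (x z : Fin m → F) : herm q (a • x) z = a * herm q x z :=
  (hermL q z).map_smul a x

theorem herm_zero_left (z : Fin m → F) : herm q 0 z = 0 := (hermL q z).map_zero

theorem herm_symm (g : Good q F) (x y : Fin m → F) : herm q y x = (herm q x y) ^ q := by
  have : (herm q x y) ^ q = g.frob (herm q x y) := rfl
  rw [this]
  simp only [herm, map_sum]
  refine Finset.sum_congr rfl fun i _ => ?_
  change _ = (x i * y i ^ q) ^ q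
  rw [mul_pow, g.pow_pow, mul_comm]

theorem herm_add_right (g : Good q F) (x y z : Fin m → F) :
    herm q z (x + y) = herm q z x + herm q z y := by
  rw [herm_symm g (x + y) z, herm_symm g x z, herm_symm g y z, herm_add_left, g.add_pow]

theorem herm_smul_right (g : Good q F) (a : F) (x z : Fin m → F) :
    herm q z (a • x) = a ^ q * herm q z x := by
  rw [herm_symm g (a • x) z, herm_symm g x z, herm_smul_left, mul_pow]

theorem herm_zero_right (g : Good q F) (z : Fin m → F) : herm q z 0 = 0 := by
  rw [herm_symm g 0 z, herm_zero_left, zero_pow g.ne_zero]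

theorem herm_comm_zero (g : Good q F) {x y : Fin m → F} (h : herm q x y = 0) : herm q y x = 0 := by
  rw [herm_symm g x y, h, zero_pow g.ne_zero]

theorem herm_self_fixed (g : Good q F) (x : Fin m → F) : (herm q x x) ^ q = herm q x x :=
  (herm_symm g x x).symm

theorem mem_polar {W : Submodule F (Fin m → F)} {y : Fin m → F} :
    y ∈ polar q W ↔ ∀ x ∈ W, herm q y x = 0 := by
  simp only [polar, Submodule.mem_iInf, LinearMap.mem_ker, Subtype.forall]
  rfl

/-- conjugate subspace -/
def conjSub (g : Good q F) (W : Submodule F (Fin m → F)) : Submodule F (Fin m → F) where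
  carrier := {x | (fun i => x i ^ q) ∈ W}
  add_mem' {a b} ha hb := by
    have : (fun i => (a + b) i ^ q) = (fun i => a i ^ q) + (fun i => b i ^ q) := by
      funext i; exact g.add_pow _ _
    simp only [Set.mem_ofPred_eq] at *
    rw [this]; exact W.add_mem ha hb
  zero_mem' := by
    have : (fun i => (0 : Fin m → F) i ^ q) = 0 := by
      funext i; exact zero_pow g.ne_zero
    simp only [Set.mem_ofPred_eq]
    rw [this]; exact W.zero_mem
  smul_mem' c x hx := by
    have : (fun i => (c • x) i ^ q) = (c ^ q) • (fun i => x i ^ q) := by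
      funext i; exact mul_pow _ _ _
    simp only [Set.mem_ofPred_eq] at *
    rw [this]; exact W.smul_mem _ hx

theorem finrank_eq_of_card (g : Good q F) {W W' : Submodule F (Fin m → F)}
    (h : Nat.card W = Nat.card W') : Module.finrank F W = Module.finrank F W' := by
  rw [Module.natCard_eq_pow_finrank (K := F), Module.natCard_eq_pow_finrank (K := F) (V := W')] at h
  refine Nat.pow_right_injective ?_ h
  rw [g.natCard]; have := g.one_lt; nlinarith

theorem finrank_conjSub (g : Good q F) (W : Submodule F (Fin m → F)) :
    Module.finrank F (conjSub g W) = Module.finrank F W := by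
  apply finrank_eq_of_card g
  refine Nat.card_congr ⟨fun x => ⟨fun i => x.1 i ^ q, x.2⟩, fun y => ⟨fun i => y.1 i ^ q, ?_⟩, ?_, ?_⟩
  · change (fun i => (y.1 i ^ q) ^ q) ∈ W
    simp only [g.pow_pow]; exact y.2
  · intro x; ext i; exact g.pow_pow _
  · intro x; ext i; exact g.pow_pow _

theorem finrank_polar (g : Good q F) (W : Submodule F (Fin m → F)) :
    Module.finrank F (polar q W) = m - Module.finrank F W := by
  let B : LinearMap.BilinForm F (Fin m → F) := dotProductBilin F F
  have hB : B.Nondegenerate := by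
    constructor
    · intro x hx
      funext i
      have := hx (Pi.single i 1)
      simpa [B] using this
    · intro x hx
      funext i
      have := hx (Pi.single i 1)
      simpa [B] using this
  have h := LinearMap.BilinForm.finrank_orthogonal hB (conjSub g W)
  rw [finrank_conjSub] at h
  simp only [Module.finrank_fintype_fun_eq_card, Fintype.card_fin] at h
  rw [← h]
  suffices polar q W = B.orthogonal (conjSub g W) by rw [this]
  ext y
  rw [mem_polar, LinearMap.BilinForm.mem_orthogonal_iff]
  constructor
  · intro hy x hx
    have := hy _ hx
    simp only [herm, g.pow_pow] at this
    change x ⬝ᵥ y = 0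
    rw [dotProduct_comm]; exact this
  · intro hy x hx
    have hx' : (fun i => x i ^ q) ∈ conjSub g W := by
      change (fun i => (x i ^ q) ^ q) ∈ W
      simp only [g.pow_pow]; exact hx
    have := hy _ hx'
    change (fun i => x i ^ q) ⬝ᵥ y = 0 at this
    rw [dotProduct_comm] at this
    exact this

theorem finrank_le_m (W : Submodule F (Fin m → F)) : Module.finrank F W ≤ m := by
  have := Submodule.finrank_le W
  simpa using this

theorem le_polar_polar (g : Good q F) (W : Submodule F (Fin m → F)) :
    W ≤ polar q (polar q W) := by
  intro x hx
  rw [mem_polar]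
  intro y hy
  exact herm_comm_zero g (mem_polar.1 hy x hx)

theorem polar_polar (g : Good q F) (W : Submodule F (Fin m → F)) :
    polar q (polar q W) = W := by
  symm
  apply Submodule.eq_of_le_of_finrank_le (le_polar_polar g W)
  rw [finrank_polar g, finrank_polar g]
  have := finrank_le_m W
  omega

theorem polar_anti {W W' : Submodule F (Fin m → F)} (h : W ≤ W') : polar q W' ≤ polar q W :=
  fun _ hx => mem_polar.2 fun y hy => mem_polar.1 hx y (h hy)

theorem polar_sup (g : Good q F) (W W' : Submodule F (Fin m → F)) :
    polar q (W ⊔ W') = polar q W ⊓ polar q W' := by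
  apply le_antisymm
  · exact le_inf (polar_anti le_sup_left) (polar_anti le_sup_right)
  · intro x hx
    rw [mem_polar]
    intro y hy
    obtain ⟨a, ha, b, hb, rfl⟩ := Submodule.mem_sup.1 hy
    rw [herm_add_right g, mem_polar.1 hx.1 a ha, mem_polar.1 hx.2 b hb, add_zero]

theorem polar_inf (g : Good q F) (W W' : Submodule F (Fin m → F)) :
    polar q (W ⊓ W') = polar q W ⊔ polar q W' := by
  conv_lhs => rw [← polar_polar g W, ← polar_polar g W', ← polar_sup g]
  exact polar_polar g _

theorem mem_polar_span (g : Good q F) {x y : Fin m → F} :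
    y ∈ polar q (F ∙ x) ↔ herm q y x = 0 := by
  rw [mem_polar]
  constructor
  · intro h; exact h x (Submodule.mem_span_singleton_self x)
  · intro h z hz
    obtain ⟨a, rfl⟩ := Submodule.mem_span_singleton.1 hz
    rw [herm_smul_right g, h, mul_zero]

theorem le_polar_comm (g : Good q F) {W W' : Submodule F (Fin m → F)} :
    W ≤ polar q W' ↔ W' ≤ polar q W := by
  constructor <;> intro h <;> have := polar_anti (q := q) h <;> rwa [polar_polar g] at this

theorem le_polar_span (g : Good q F) {W : Submodule F (Fin m → F)} {x : Fin m → F} :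
    W ≤ polar q (F ∙ x) ↔ x ∈ polar q W := by
  rw [le_polar_comm g, Submodule.span_singleton_le_iff_mem]

theorem finrank_inf_polar_span (g : Good q F) {W : Submodule F (Fin m → F)} {v x : Fin m → F}
    (hx : x ∈ W) (hxv : herm q x v ≠ 0) :
    Module.finrank F (W ⊓ polar q (F ∙ v) : Submodule F (Fin m → F)) + 1 = Module.finrank F W := by
  have hv : v ≠ 0 := by rintro rfl; exact hxv (herm_zero_right g x)
  have h1 := finrank_polar g (F ∙ v)
  rw [finrank_span_singleton hv] at h1
  have h2 := Submodule.finrank_sup_add_finrank_inf_eq W (polar q (F ∙ v))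
  have h3 : polar q (F ∙ v) < W ⊔ polar q (F ∙ v) := by
    refine lt_of_le_of_ne le_sup_right fun h => hxv ?_
    rw [← mem_polar_span g, h]
    exact Submodule.mem_sup_left hx
  have h4 := Submodule.finrank_lt_finrank_of_lt h3
  have h5 := finrank_le_m (W ⊔ polar q (F ∙ v))
  omega

theorem polar_span_sup_top (g : Good q F) {v x : Fin m → F} (hxv : herm q x v ≠ 0) :
    polar q (F ∙ v) ⊔ (F ∙ x) = ⊤ := by
  apply Submodule.eq_top_of_finrank_eq
  have hv : v ≠ 0 := by rintro rfl; exact hxv (herm_zero_right g x)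
  have h1 := finrank_polar g (F ∙ v)
  rw [finrank_span_singleton hv] at h1
  have : x ∉ polar q (F ∙ v) := fun h => hxv ((mem_polar_span g).1 h)
  rw [Submodule.finrank_sup_span_singleton this, h1]
  have h6 := finrank_le_m (F ∙ v)
  rw [finrank_span_singleton hv] at h6
  simp; omega

/-! ### finite field counting -/

theorem card_root_le (g : Good q F) (e : F) : Nat.card {x : F // x ^ q + e * x = 0} ≤ q := by
  classical
  let f : Polynomial F := Polynomial.X ^ q + Polynomial.C e * Polynomial.X
  have hdeg : f.natDegree = q := by
    have := g.one_lt
    apply Polynomial.natDegree_eq_of_degree_eq_some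
    rw [Polynomial.degree_add_eq_left_of_degree_lt]
    · simp
    · calc _ ≤ (1 : WithBot ℕ) := Polynomial.degree_C_mul_X_le e
        _ < _ := by rw [Polynomial.degree_X_pow]; exact_mod_cast this
  have hf : f ≠ 0 := by
    intro h; rw [h] at hdeg; simp at hdeg; exact g.ne_zero hdeg.symm
  rw [Nat.card_eq_fintype_card, Fintype.card_subtype]
  calc _ ≤ f.roots.toFinset.card := by
        apply Finset.card_le_card
        intro x hx
        simp only [Finset.mem_filter, Finset.mem_univ, true_and] at hx
        simp [hf, f, hx]
    _ ≤ Multiset.card f.roots := Multiset.toFinset_card_le _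
    _ ≤ f.natDegree := Polynomial.card_roots' f
    _ = q := hdeg

/-- trace -/
def Good.tr (g : Good q F) : F →+ F := AddMonoidHom.id F + g.frob.toAddMonoidHom

theorem Good.tr_apply (g : Good q F) (x : F) : g.tr x = x + x ^ q := rfl

theorem tr_facts (g : Good q F) : Nat.card g.tr.ker = q ∧
    Nat.card {c : F // c ^ q = c} = q ∧ ∀ c : F, c ^ q = c → ∃ t, g.tr t = c := by
  classical
  have h1 : Nat.card g.tr.ker ≤ q := by
    refine le_trans (le_of_eq ?_) (card_root_le g 1)
    apply Nat.card_congr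
    refine Equiv.subtypeEquivRight fun x => ?_
    rw [AddMonoidHom.mem_ker, g.tr_apply, one_mul, add_comm]
  have h2 : Nat.card {c : F // c ^ q = c} ≤ q := by
    refine le_trans (le_of_eq ?_) (card_root_le g (-1))
    apply Nat.card_congr
    refine Equiv.subtypeEquivRight fun x => ?_
    rw [neg_one_mul, ← sub_eq_add_neg, sub_eq_zero]
  let φ : g.tr.range → {c : F // c ^ q = c} := fun c => ⟨c.1, by
    obtain ⟨t, ht⟩ := c.2
    rw [← ht, g.tr_apply, g.add_pow, g.pow_pow, add_comm]⟩
  have hφ : Function.Injective φ := by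
    intro a b h
    exact Subtype.ext (congrArg (fun x : {c : F // c ^ q = c} => x.1) h)
  have h3 : Nat.card g.tr.range ≤ Nat.card {c : F // c ^ q = c} :=
    Nat.card_le_card_of_injective φ hφ
  have h4 : Nat.card g.tr.range * Nat.card g.tr.ker = q ^ 2 := by
    rw [← g.natCard, AddSubgroup.card_eq_card_quotient_mul_card_addSubgroup g.tr.ker]
    congr 1
    exact (Nat.card_congr (QuotientAddGroup.quotientKerEquivRange g.tr).toEquiv).symm
  have hq := g.one_lt
  have h5 : Nat.card g.tr.ker = q := by nlinarith
  have h6 : Nat.card g.tr.range = q := by rw [h5] at h4; nlinarith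
  refine ⟨h5, by omega, ?_⟩
  have hb : Function.Bijective φ := by
    rw [Nat.bijective_iff_injective_and_card]
    exact ⟨hφ, by omega⟩
  intro c hc
  obtain ⟨⟨y, t, ht⟩, hy⟩ := hb.2 ⟨c, hc⟩
  exact ⟨t, by rw [ht]; exact congrArg Subtype.val hy⟩

theorem card_tr_fiber (g : Good q F) (c : F) (hc : c ^ q = c) :
    Nat.card {t : F // t + t ^ q = c} = q := by
  obtain ⟨h1, -, h3⟩ := tr_facts g
  obtain ⟨t0, ht0⟩ := h3 c hc
  refine Eq.trans ?_ h1
  apply Nat.card_congr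
  refine (Equiv.addRight (-t0)).subtypeEquiv fun t => ?_
  change g.tr t = c ↔ g.tr (t + -t0) = 0
  rw [map_add, map_neg, ht0, ← sub_eq_add_neg, sub_eq_zero]

theorem exists_tr_ne (g : Good q F) : ∃ t : F, t + t ^ q ≠ 0 := by
  obtain ⟨t, ht⟩ := (tr_facts g).2.2 1 (one_pow q)
  exact ⟨t, by rw [← g.tr_apply, ht]; exact one_ne_zero⟩

theorem exists_norm (g : Good q F) (c : F) (hc : c ^ q = c) (hc0 : c ≠ 0) :
    ∃ a : F, a ≠ 0 ∧ a * a ^ q = c := by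
  obtain ⟨x, hx⟩ := IsCyclic.exists_generator (α := Fˣ)
  obtain ⟨j, hj⟩ := Subgroup.mem_zpowers_iff.1 (hx (Units.mk0 c hc0))
  have hord : orderOf x = q ^ 2 - 1 := by
    rw [orderOf_eq_card_of_forall_mem_zpowers hx, Nat.card_units, g.natCard]
  have hq := g.one_lt
  obtain ⟨r, rfl⟩ : ∃ r, q = r + 1 := ⟨q - 1, by omega⟩
  have h1 : x ^ (j * r) = 1 := by
    rw [zpow_mul, hj]
    ext
    simp only [zpow_natCast, Units.val_pow_eq_pow_val, Units.val_mk0, Units.val_one]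
    rw [pow_succ] at hc
    exact mul_right_cancel₀ hc0 (by rw [hc, one_mul])
  rw [← orderOf_dvd_iff_zpow_eq_one, hord] at h1
  have h2 : (((r + 1) ^ 2 - 1 : ℕ) : ℤ) = (r + 2) * r := by
    rw [Nat.cast_sub (by nlinarith)]; push_cast; ring
  rw [h2] at h1
  have h3 : ((r : ℤ) + 2) ∣ j := by
    refine Int.dvd_of_mul_dvd_mul_right ?_ h1
    omega
  obtain ⟨k, rfl⟩ := h3
  refine ⟨(x ^ k : Fˣ), Units.ne_zero _, ?_⟩
  have := congrArg Units.val hj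
  simp only [Units.val_mk0] at this
  rw [← this, ← Units.val_pow_eq_pow_val, ← Units.val_mul]
  congr 1
  rw [← zpow_natCast, ← zpow_mul, ← zpow_add]
  congr 1
  push_cast; ring

theorem isotropic_iff (g : Good q F) {W : Submodule F (Fin m → F)} :
    TotallyIsotropic q W ↔ W ≤ polar q W := by
  constructor
  · intro h x hx
    rw [mem_polar]
    intro y hy
    by_contra hne
    obtain ⟨t, ht⟩ := exists_tr_ne g
    have h1 := h ((t / herm q x y) • x + y) (W.add_mem (W.smul_mem _ hx) hy)
    rw [herm_add_left, herm_add_right g, herm_add_right g, h y hy] at h1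
    rw [herm_smul_right g, herm_smul_left, h x hx, herm_smul_left, herm_smul_right g,
      herm_symm g x y, ← mul_pow, div_mul_cancel₀ _ hne] at h1
    apply ht
    simpa using h1
  · intro h x hx
    exact mem_polar.1 (h hx) x hx

end base


section count
variable {q : ℕ} {F : Type} [Field F] [Fintype F] {m : ℕ}

/-- number of vectors of `W` of norm `c`. -/
noncomputable def nv (q : ℕ) {F : Type} [Field F] {m : ℕ} (W : Submodule F (Fin m → F)) (c : F) : ℕ :=
  Nat.card {w : Fin m → F // w ∈ W ∧ herm q w w = c}

theorem herm_smul_self (g : Good q F) (a : F) (x : Fin m → F) :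
    herm q (a • x) (a • x) = a * a ^ q * herm q x x := by
  rw [herm_smul_left, herm_smul_right g, mul_assoc]

theorem nv_scale (g : Good q F) (W : Submodule F (Fin m → F)) (c : F) (hc : c ^ q = c)
    (hc0 : c ≠ 0) : nv q W c = nv q W 1 := by
  obtain ⟨a, ha, hac⟩ := exists_norm g c hc hc0
  symm
  apply Nat.card_congr
  refine (LinearEquiv.smulOfNeZero F (Fin m → F) a ha).toEquiv.subtypeEquiv fun w => ?_
  change _ ↔ a • w ∈ W ∧ herm q (a • w) (a • w) = c
  rw [W.smul_mem_iff ha, herm_smul_self g, hac]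
  constructor
  · rintro ⟨h1, h2⟩; exact ⟨h1, by rw [h2, mul_one]⟩
  · rintro ⟨h1, h2⟩; exact ⟨h1, mul_left_cancel₀ hc0 (by rw [h2, mul_one])⟩

theorem natCard_sub (g : Good q F) (W : Submodule F (Fin m → F)) :
    Nat.card W = (q ^ 2) ^ Module.finrank F W := by
  rw [Module.natCard_eq_pow_finrank (K := F), g.natCard]

theorem nv_total (g : Good q F) (W : Submodule F (Fin m → F)) :
    nv q W 0 + (q - 1) * nv q W 1 = (q ^ 2) ^ Module.finrank F W := by
  classical
  rw [← natCard_sub g]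
  have e : W ≃ Σ c : {c : F // c ^ q = c}, {w : Fin m → F // w ∈ W ∧ herm q w w = c.1} :=
    { toFun := fun w => ⟨⟨herm q w.1 w.1, herm_self_fixed g _⟩, ⟨w.1, w.2, rfl⟩⟩
      invFun := fun s => ⟨s.2.1, s.2.2.1⟩
      left_inv := fun w => rfl
      right_inv := by
        rintro ⟨⟨c, hc⟩, ⟨w, hw, h⟩⟩
        have h' : herm q w w = c := h
        subst h'
        rfl }
  rw [Nat.card_congr e, Nat.card_sigma]
  change _ = ∑ c : {c : F // c ^ q = c}, nv q W c.1
  have h0 : (0 : F) ^ q = 0 := zero_pow g.ne_zero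
  rw [← Finset.add_sum_erase Finset.univ _ (Finset.mem_univ (⟨0, h0⟩ : {c : F // c ^ q = c}))]
  congr 1
  rw [Finset.sum_congr rfl (g := fun _ => nv q W 1)]
  · rw [Finset.sum_const, Finset.card_erase_of_mem (Finset.mem_univ _), Finset.card_univ,
      ← Nat.card_eq_fintype_card, (tr_facts g).2.1, smul_eq_mul]
  · intro c hc
    apply nv_scale g _ _ c.2
    intro h
    exact (Finset.mem_erase.1 hc).1 (Subtype.ext h)

theorem nv_rec (g : Good q F) (W : Submodule F (Fin m → F)) (v : Fin m → F) (hv : v ∈ W)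
    (hd : herm q v v ≠ 0) :
    nv q W 0 = nv q (W ⊓ polar q (F ∙ v)) 0 + (q ^ 2 - 1) * nv q (W ⊓ polar q (F ∙ v)) 1 := by
  classical
  set W' := W ⊓ polar q (F ∙ v) with hW'
  set d := herm q v v with hdd
  have key : ∀ (a : F) (w : Fin m → F), herm q w v = 0 →
      herm q (w + a • v) (w + a • v) = herm q w w + a * a ^ q * d := by
    intro a w h
    rw [herm_add_left, herm_add_right g, herm_add_right g, herm_smul_self g, herm_smul_right g,
      herm_smul_left, h, herm_comm_zero g h]
    simp [hdd]
  have e : {w : Fin m → F // w ∈ W ∧ herm q w w = 0} ≃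
      Σ a : F, {w : Fin m → F // w ∈ W' ∧ herm q w w = -(a * a ^ q * d)} :=
    { toFun := fun w => ⟨herm q w.1 v / d, ⟨w.1 - (herm q w.1 v / d) • v, by
        have h0 : herm q (w.1 - (herm q w.1 v / d) • v) v = 0 := by
          rw [sub_eq_add_neg, ← neg_smul, herm_add_left, herm_smul_left, ← hdd, neg_mul,
            div_mul_cancel₀ _ hd, add_neg_cancel]
        refine ⟨⟨W.sub_mem w.2.1 (W.smul_mem _ hv), (mem_polar_span g).2 h0⟩, ?_⟩
        have := key (herm q w.1 v / d) _ h0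
        rw [sub_add_cancel, w.2.2] at this
        exact eq_neg_of_add_eq_zero_left this.symm⟩⟩
      invFun := fun s => ⟨s.2.1 + s.1 • v, W.add_mem s.2.2.1.1 (W.smul_mem _ hv), by
        rw [key _ _ ((mem_polar_span g).1 s.2.2.1.2), s.2.2.2, neg_add_cancel]⟩
      left_inv := fun w => by ext1; exact sub_add_cancel _ _
      right_inv := by
        rintro ⟨a, ⟨w, hw, hw2⟩⟩
        have h1 : herm q (w + a • v) v / d = a := by
          rw [herm_add_left, herm_smul_left, (mem_polar_span g).1 hw.2, zero_add, ← hdd,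
            mul_div_cancel_right₀ _ hd]
        simp only
        have : ∀ (b : F) (hb : b = a) (x : Fin m → F) (hx : x = w)
          (h : x ∈ W' ∧ herm q x x = -(b * b ^ q * d)),
          (⟨b, ⟨x, h⟩⟩ : Σ a : F, {w : Fin m → F // w ∈ W' ∧ herm q w w = -(a * a ^ q * d)})
            = ⟨a, ⟨w, hw, hw2⟩⟩ := by
          rintro _ rfl _ rfl _; rfl
        apply this
        · exact h1
        · rw [h1, add_sub_cancel_right] }
  have e1 : nv q W 0 = ∑ a : F, nv q W' (-(a * a ^ q * d)) := by
    unfold nv; rw [Nat.card_congr e, Nat.card_sigma]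
  rw [e1, ← Finset.add_sum_erase Finset.univ _ (Finset.mem_univ (0 : F))]
  congr 1
  · simp
  · rw [Finset.sum_congr rfl (g := fun _ => nv q W' 1)]
    · rw [Finset.sum_const, Finset.card_erase_of_mem (Finset.mem_univ _), Finset.card_univ,
        g.card, smul_eq_mul]
    · intro a ha
      have ha0 := (Finset.mem_erase.1 ha).1
      apply nv_scale g
      · rw [g.neg_pow, mul_pow, mul_pow, g.pow_pow, hdd, herm_self_fixed g, mul_comm (a ^ q)]
      · simp [hd, ha0]

theorem rad_inf (g : Good q F) (W : Submodule F (Fin m → F)) (v : Fin m → F) (hv : v ∈ W)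
    (hd : herm q v v ≠ 0) :
    (W ⊓ polar q (F ∙ v)) ⊓ polar q (W ⊓ polar q (F ∙ v)) = W ⊓ polar q W := by
  rw [polar_inf g, polar_polar g]
  ext x
  constructor
  · rintro ⟨⟨h1, h2⟩, h3⟩
    obtain ⟨y, hy, z, hz, rfl⟩ := Submodule.mem_sup.1 h3
    obtain ⟨a, rfl⟩ := Submodule.mem_span_singleton.1 hz
    have h4 := (mem_polar_span g).1 h2
    rw [herm_add_left, herm_smul_left, mem_polar.1 hy v hv, zero_add] at h4
    have ha : a = 0 := (mul_eq_zero.1 h4).resolve_right hd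
    subst ha
    simp only [zero_smul, add_zero] at *
    exact ⟨h1, hy⟩
  · rintro ⟨h1, h2⟩
    exact ⟨⟨h1, (mem_polar_span g).2 (mem_polar.1 h2 v hv)⟩, Submodule.mem_sup_left h2⟩

theorem exists_nonisotropic (g : Good q F) {W : Submodule F (Fin m → F)}
    (h : Module.finrank F W ≠ Module.finrank F (W ⊓ polar q W : Submodule F (Fin m → F))) :
    ∃ v ∈ W, herm q v v ≠ 0 := by
  by_contra! hcon
  have := (isotropic_iff g).1 hcon
  rw [inf_eq_left.2 this] at h
  exact h rfl

theorem nv_formula (g : Good q F) (k : ℕ) : ∀ (W : Submodule F (Fin m → F)),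
    Module.finrank F W = Module.finrank F (W ⊓ polar q W : Submodule F (Fin m → F)) + k →
    (q : ℚ) * nv q W 0 = ((q : ℚ) ^ 2) ^ (Module.finrank F (W ⊓ polar q W : Submodule F (Fin m → F)))
        * (q ^ (2 * k) + (-1) ^ k * (q - 1) * q ^ k) ∧
    (q : ℚ) * nv q W 1 = ((q : ℚ) ^ 2) ^ (Module.finrank F (W ⊓ polar q W : Submodule F (Fin m → F)))
        * (q ^ (2 * k) - (-1) ^ k * q ^ k) := by
  have hq := g.one_lt
  have hq1 : (q : ℚ) - 1 ≠ 0 := by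
    have : (1 : ℚ) < q := by exact_mod_cast hq
    linarith
  induction k with
  | zero =>
    intro W hW
    have h1 : W ⊓ polar q W = W := Submodule.eq_of_le_of_finrank_eq inf_le_left hW.symm
    have h2 : nv q W 0 = (q ^ 2) ^ Module.finrank F W := by
      rw [← natCard_sub g]
      apply Nat.card_congr
      refine Equiv.subtypeEquivRight fun w => ⟨fun h => h.1, fun h => ⟨h, ?_⟩⟩
      exact mem_polar.1 (inf_eq_left.1 h1 h) w h
    have h3 := nv_total g W
    have h4 : nv q W 1 = 0 := by
      rw [h2] at h3
      have : (q - 1) * nv q W 1 = 0 := by omega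
      rcases Nat.mul_eq_zero.1 this with h | h
      · omega
      · exact h
    rw [h1, h2, h4]
    push_cast
    constructor <;> ring
  | succ k ih =>
    intro W hW
    obtain ⟨v, hv, hd⟩ := exists_nonisotropic g (W := W) (by omega)
    have h1 := nv_rec g W v hv hd
    have h2 := nv_total g W
    have h3 := finrank_inf_polar_span g hv hd
    have h4 := ih (W ⊓ polar q (F ∙ v)) (by rw [rad_inf g W v hv hd]; omega)
    rw [rad_inf g W v hv hd] at h4
    rw [hW] at h2
    set r := Module.finrank F (W ⊓ polar q W : Submodule F (Fin m → F))
    have h1' := congrArg (Nat.cast : ℕ → ℚ) h1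
    have h2' := congrArg (Nat.cast : ℕ → ℚ) h2
    rw [Nat.cast_add, Nat.cast_mul, Nat.cast_sub (by nlinarith)] at h1'
    rw [Nat.cast_add, Nat.cast_mul, Nat.cast_sub (by omega)] at h2'
    push_cast at h1' h2'
    have h5 : (q : ℚ) * nv q W 0 = ((q : ℚ) ^ 2) ^ r
        * (q ^ (2 * (k + 1)) + (-1) ^ (k + 1) * (q - 1) * q ^ (k + 1)) := by
      rw [h1', mul_add, h4.1, mul_left_comm, h4.2]; ring
    refine ⟨h5, ?_⟩
    apply mul_left_cancel₀ hq1
    have h6 : ((q : ℚ) - 1) * (q * nv q W 1) = q * ((q : ℚ) ^ 2) ^ (r + (k + 1)) - q * nv q W 0 := by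
      rw [← h2']; ring
    rw [h6, h5]; ring

end count


section states
variable {q : ℕ} {F : Type} [Field F] [Fintype F] {m : ℕ}

/-- The generators through `Z` meeting `α`, `α^σ` in given dimensions. -/
def St (q : ℕ) {F : Type} [Field F] {m : ℕ} (Z α : Submodule F (Fin m → F)) (j k : ℕ)
    (G : Submodule F (Fin m → F)) : Prop :=
  polar q G = G ∧ Z ≤ G ∧
  Module.finrank F (G ⊓ (α ⊓ polar q α) : Submodule F (Fin m → F)) = Module.finrank F Z ∧
  Module.finrank F (G ⊓ α : Submodule F (Fin m → F)) = Module.finrank F Z + j ∧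
  Module.finrank F (G ⊓ polar q α : Submodule F (Fin m → F)) = Module.finrank F Z + k

/-- number of such generators -/
noncomputable def cSt (q : ℕ) {F : Type} [Field F] {m : ℕ} (Z α : Submodule F (Fin m → F))
    (j k : ℕ) : ℕ := Nat.card {G : Submodule F (Fin m → F) // St q Z α j k G}

theorem St_swap (g : Good q F) (Z α G : Submodule F (Fin m → F)) (j k : ℕ) :
    St q Z α j k G ↔ St q Z (polar q α) k j G := by
  unfold St
  rw [polar_polar g, inf_comm (polar q α) α]
  tauto

theorem cSt_swap (g : Good q F) (Z α : Submodule F (Fin m → F)) (j k : ℕ) :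
    cSt q Z α j k = cSt q Z (polar q α) k j := by
  apply Nat.card_congr
  exact Equiv.subtypeEquivRight fun G => St_swap g Z α G j k

theorem dc {A B : Type} [Finite A] [Finite B] (r : A → B → Prop) (s t : ℕ)
    (h1 : ∀ a, Nat.card {b // r a b} = s) (h2 : ∀ b, Nat.card {a // r a b} = t) :
    Nat.card A * s = Nat.card B * t := by
  classical
  have := Fintype.ofFinite A
  have := Fintype.ofFinite B
  have e : (Σ a, {b // r a b}) ≃ Σ b, {a // r a b} :=
    { toFun := fun x => ⟨x.2.1, ⟨x.1, x.2.2⟩⟩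
      invFun := fun x => ⟨x.2.1, ⟨x.1, x.2.2⟩⟩
      left_inv := fun _ => rfl
      right_inv := fun _ => rfl }
  have h := Nat.card_congr e
  rw [Nat.card_sigma, Nat.card_sigma] at h
  simp only [h1, h2, Finset.sum_const, Finset.card_univ, smul_eq_mul] at h
  rw [Nat.card_eq_fintype_card, Nat.card_eq_fintype_card]
  exact h

theorem card_affine (g : Good q F) (W : Submodule F (Fin m → F)) (z x : Fin m → F) (hx : x ∈ W)
    (hxz : herm q x z ≠ 0) :
    Nat.card {w : Fin m → F // w ∈ W ∧ herm q w z = 1} * q ^ 2 = (q ^ 2) ^ Module.finrank F W := by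
  have h1 := finrank_inf_polar_span g hx hxz
  rw [← h1, pow_succ (q ^ 2), ← natCard_sub g]
  congr 1
  set x1 := (herm q x z)⁻¹ • x with hx1
  have hx1W : x1 ∈ W := W.smul_mem _ hx
  have hx1z : herm q x1 z = 1 := by rw [hx1, herm_smul_left, inv_mul_cancel₀ hxz]
  apply Nat.card_congr
  refine (Equiv.addRight (-x1)).subtypeEquiv fun w => ?_
  change _ ↔ w + -x1 ∈ W ∧ w + -x1 ∈ polar q (F ∙ z)
  rw [mem_polar_span g, ← neg_one_smul F x1, herm_add_left, herm_smul_left, hx1z, neg_one_smul,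
    ← sub_eq_add_neg, W.sub_mem_iff_left hx1W, mul_one, ← sub_eq_add_neg, sub_eq_zero]

theorem card_iso_affine (g : Good q F) (W : Submodule F (Fin m → F)) (z x : Fin m → F) (hx : x ∈ W)
    (hxz : herm q x z ≠ 0) (hz : z ∈ W) (hzz : herm q z z = 0) :
    Nat.card {w : Fin m → F // w ∈ W ∧ herm q w z = 1 ∧ herm q w w = 0} * (q ^ 2) ^ 2
      = q * (q ^ 2) ^ Module.finrank F W := by
  have hz0 : z ≠ 0 := by rintro rfl; exact hxz (herm_zero_right g x)
  have hinj : ∀ s t : F, s • z = t • z → s = t := fun s t h => smul_left_injective F hz0 h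
  have h := dc (A := {w : Fin m → F // w ∈ W ∧ herm q w z = 1})
    (B := {w : Fin m → F // w ∈ W ∧ herm q w z = 1 ∧ herm q w w = 0})
    (fun a b => ∃ t : F, b.1 = a.1 + t • z) q (q ^ 2) ?_ ?_
  · rw [pow_two (q ^ 2), ← mul_assoc, ← h, ← card_affine g W z x hx hxz]; ring
  · rintro ⟨a, haW, ha⟩
    have hza : herm q z a = 1 := by rw [herm_symm g a z, ha, one_pow]
    have key : ∀ t : F, herm q (a + t • z) (a + t • z) = herm q a a + (t + t ^ q) := by
      intro t
      rw [herm_add_left, herm_add_right g, herm_add_right g, herm_smul_self g, herm_smul_right g,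
        herm_smul_left, ha, hza, hzz]; ring
    refine Eq.trans ?_ (card_tr_fiber g (-herm q a a) (by rw [g.neg_pow, herm_self_fixed g]))
    symm
    refine Nat.card_congr (Equiv.ofBijective (fun t => ⟨⟨a + t.1 • z, W.add_mem haW (W.smul_mem _ hz),
      ?_, ?_⟩, t.1, rfl⟩) ⟨?_, ?_⟩)
    · rw [herm_add_left, herm_smul_left, hzz, ha]; simp
    · rw [key, t.2, add_neg_cancel]
    · intro s t hst
      have := congrArg (fun x => x.1.1) hst
      exact Subtype.ext (hinj _ _ (add_left_cancel this))
    · rintro ⟨⟨b, hb⟩, t, ht⟩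
      simp only at ht
      subst ht
      refine ⟨⟨t, ?_⟩, rfl⟩
      have := hb.2.2
      rw [key] at this
      exact eq_neg_of_add_eq_zero_right this
  · rintro ⟨b, hbW, hb, hb2⟩
    rw [← g.natCard]
    symm
    refine Nat.card_congr (Equiv.ofBijective (fun t : F => ⟨⟨b + t • z,
      W.add_mem hbW (W.smul_mem _ hz), ?_⟩, -t, ?_⟩) ⟨?_, ?_⟩)
    · rw [herm_add_left, herm_smul_left, hzz, hb]; simp
    · simp
    · intro s t hst
      have := congrArg (fun x => x.1.1) hst
      exact (hinj _ _ (add_left_cancel this))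
    · rintro ⟨⟨a, ha⟩, t, ht⟩
      simp only at ht
      refine ⟨-t, ?_⟩
      apply Subtype.ext
      apply Subtype.ext
      simp [ht]

/-- moving the generator `G` through a point -/
def mv (q : ℕ) {F : Type} [Field F] {m : ℕ} (G : Submodule F (Fin m → F)) (z : Fin m → F) :
    Submodule F (Fin m → F) := (G ⊓ polar q (F ∙ z)) ⊔ (F ∙ z)

theorem span_le_polar (g : Good q F) {z : Fin m → F} (hz : herm q z z = 0) :
    (F ∙ z) ≤ polar q (F ∙ z) := by
  rw [Submodule.span_singleton_le_iff_mem, mem_polar_span g, hz]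

theorem polar_mv (g : Good q F) {G : Submodule F (Fin m → F)} {z : Fin m → F}
    (hG : polar q G = G) (hz : herm q z z = 0) : polar q (mv q G z) = mv q G z := by
  unfold mv
  rw [polar_sup g, polar_inf g, hG, polar_polar g, inf_comm G, inf_sup_assoc_of_le _ (span_le_polar g hz),
    inf_comm]

theorem mem_gen (g : Good q F) {G : Submodule F (Fin m → F)} (hG : polar q G = G)
    {x y : Fin m → F} (hx : x ∈ G) (hy : y ∈ G) : herm q x y = 0 := by
  rw [← hG] at hx
  exact mem_polar.1 hx y hy

theorem gen_le (g : Good q F) {G : Submodule F (Fin m → F)} (hG : polar q G = G)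
    {x : Fin m → F} (hx : x ∈ G) : G ≤ polar q (F ∙ x) := by
  rw [le_polar_span g, hG]; exact hx

theorem mv_mv (g : Good q F) {G : Submodule F (Fin m → F)} {z w : Fin m → F}
    (hG : polar q G = G) (hz : z ∈ G) (hw : herm q w z ≠ 0) :
    mv q (mv q G w) z = G := by
  unfold mv
  have h1 : (G ⊓ polar q (F ∙ w) ⊔ F ∙ w) ⊓ polar q (F ∙ z) = G ⊓ polar q (F ∙ w) := by
    rw [sup_inf_assoc_of_le _ (inf_le_left.trans (gen_le g hG hz))]
    have : (F ∙ w) ⊓ polar q (F ∙ z) = ⊥ := by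
      rw [eq_bot_iff]
      rintro x ⟨hx, hx2⟩
      obtain ⟨a, rfl⟩ := Submodule.mem_span_singleton.1 hx
      have := (mem_polar_span g).1 hx2
      rw [herm_smul_left] at this
      rw [(mul_eq_zero.1 this).resolve_right hw, zero_smul]
      exact Submodule.zero_mem _
    rw [this, sup_bot_eq]
  rw [h1, inf_sup_assoc_of_le _ ((Submodule.span_singleton_le_iff_mem _ _).2 hz),
    polar_span_sup_top g (v := w) (x := z), inf_top_eq]
  intro h
  exact hw (herm_comm_zero g h)

theorem mv_inf (g : Good q F) {G β : Submodule F (Fin m → F)} {z : Fin m → F}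
    (hz : z ∈ β) (hβ : β ≤ polar q (F ∙ z)) : mv q G z ⊓ β = (G ⊓ β) ⊔ (F ∙ z) := by
  unfold mv
  rw [sup_comm, sup_inf_assoc_of_le _ ((Submodule.span_singleton_le_iff_mem _ _).2 hz), sup_comm,
    inf_assoc, inf_eq_right.2 hβ]

theorem finrank_mv_inf (g : Good q F) {G β : Submodule F (Fin m → F)} {z : Fin m → F}
    (hz : z ∈ β) (hβ : β ≤ polar q (F ∙ z)) (hzG : z ∉ G) :
    Module.finrank F (mv q G z ⊓ β : Submodule F (Fin m → F))
      = Module.finrank F (G ⊓ β : Submodule F (Fin m → F)) + 1 := by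
  rw [mv_inf g hz hβ, Submodule.finrank_sup_span_singleton]
  exact fun h => hzG h.1

theorem finrank_gen (g : Good q F) {N : ℕ} (hm : m = 2 * N) {G : Submodule F (Fin m → F)}
    (hG : polar q G = G) : Module.finrank F G = N := by
  have := finrank_polar g G
  rw [hG] at this
  have := finrank_le_m G
  omega

/-- The step equivalence on states. -/
theorem St_mv (g : Good q F) {Z α : Submodule F (Fin m → F)} {j k : ℕ}
    (hZ : Z ≤ α ⊓ polar q α) {z : Fin m → F} (hz : z ∈ α ⊓ polar q α) (hzZ : z ∉ Z)
    {μ : Submodule F (Fin m → F)} (hzμ : z ∉ μ) (hμ : polar q μ = μ) (hZμ : Z ≤ μ) :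
    St q Z α j k μ ↔ St q (Z ⊔ (F ∙ z)) α j k (mv q μ z) := by
  have hα : α ≤ polar q (F ∙ z) := (le_polar_span g).2 hz.2
  have hα' : polar q α ≤ polar q (F ∙ z) := by
    rw [le_polar_span g, polar_polar g]; exact hz.1
  have hzz : herm q z z = 0 := (mem_polar_span g).1 (hα hz.1)
  have h1 := polar_mv g hμ hzz
  have h2 : Z ⊔ (F ∙ z) ≤ mv q μ z :=
    sup_le_sup_right (le_inf hZμ ((hZ.trans inf_le_left).trans hα)) _
  unfold St
  rw [finrank_mv_inf g hz (inf_le_left.trans hα) hzμ, finrank_mv_inf g hz.1 hα hzμ,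
    finrank_mv_inf g hz.2 hα' hzμ, Submodule.finrank_sup_span_singleton hzZ]
  simp only [h1, hμ, hZμ, h2, true_and]
  refine and_congr (by omega) (and_congr (by omega) (by omega))

theorem cSt_step (g : Good q F) {N : ℕ} (hm : m = 2 * N) {Z α : Submodule F (Fin m → F)} {j k : ℕ}
    (hZ : Z ≤ α ⊓ polar q α) {z : Fin m → F} (hz : z ∈ α ⊓ polar q α) (hzZ : z ∉ Z) :
    cSt q Z α j k * q ^ (2 * Module.finrank F Z + 1) = q ^ (2 * N) * cSt q (Z ⊔ (F ∙ z)) α j k := by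
  have hα : α ≤ polar q (F ∙ z) := (le_polar_span g).2 hz.2
  have hzz : herm q z z = 0 := (mem_polar_span g).1 (hα hz.1)
  have hZz : Z ≤ polar q (F ∙ z) := (hZ.trans inf_le_left).trans hα
  have hzσ : z ∈ polar q Z := (le_polar_span g).1 hZz
  obtain ⟨x, hx, hxz⟩ : ∃ x ∈ polar q Z, herm q x z ≠ 0 := by
    by_contra! hcon
    apply hzZ
    rw [← polar_polar g Z, mem_polar]
    intro x hx
    exact herm_comm_zero g (hcon x hx)
  have hX := card_iso_affine g (polar q Z) z x hx hxz hzσ hzz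
  have hd := dc (A := {G : Submodule F (Fin m → F) // St q Z α j k G})
    (B := {w : Fin m → F // w ∈ polar q Z ∧ herm q w z = 1 ∧ herm q w w = 0})
    (fun μ w => w.1 ∈ μ.1) ((q ^ 2) ^ (N - 1)) (cSt q (Z ⊔ (F ∙ z)) α j k) ?_ ?_
  · change cSt q Z α j k * _ = _ at hd
    have hf := finrank_polar g Z
    have hle : Module.finrank F Z + 1 ≤ N := by
      rw [← Submodule.finrank_sup_span_singleton hzZ]
      have h1 : Z ⊔ (F ∙ z) ≤ polar q (Z ⊔ (F ∙ z)) := by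
        rw [polar_sup g]
        refine sup_le (le_inf ?_ hZz) (le_inf ?_ (span_le_polar g hzz))
        · exact (hZ.trans inf_le_right).trans (polar_anti (hZ.trans inf_le_left))
        · rwa [Submodule.span_singleton_le_iff_mem]
      have h2 := Submodule.finrank_mono h1
      rw [finrank_polar g] at h2
      omega
    set d := Module.finrank F Z
    obtain ⟨e, rfl⟩ : ∃ e, N = d + 1 + e := ⟨N - (d + 1), by omega⟩
    rw [hf] at hX
    have e1 : m - d = d + 2 + 2 * e := by omega
    have e2 : d + 1 + e - 1 = d + e := by omega
    rw [e1] at hX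
    rw [e2] at hd
    set X := Nat.card {w : Fin m → F // w ∈ polar q Z ∧ herm q w z = 1 ∧ herm q w w = 0}
    have hq : 0 < q := by have := g.one_lt; omega
    have hX2 : X = q * (q ^ 2) ^ (d + 2 * e) := by
      apply Nat.eq_of_mul_eq_mul_right (m := (q ^ 2) ^ 2) (by positivity)
      rw [hX]; ring
    rw [hX2] at hd
    apply Nat.eq_of_mul_eq_mul_right (m := (q ^ 2) ^ (d + e)) (by positivity)
    rw [mul_right_comm, hd]
    ring
  · rintro ⟨μ, hμ⟩
    have hzμ : z ∉ μ := by
      intro h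
      have h1 : Z ⊔ (F ∙ z) ≤ μ ⊓ (α ⊓ polar q α) :=
        sup_le (le_inf hμ.2.1 hZ) ((Submodule.span_singleton_le_iff_mem _ _).2 ⟨h, hz⟩)
      have h2 := Submodule.finrank_mono h1
      rw [hμ.2.2.1, Submodule.finrank_sup_span_singleton hzZ] at h2
      omega
    obtain ⟨y, hy, hyz⟩ : ∃ y ∈ μ, herm q y z ≠ 0 := by
      by_contra! hcon
      apply hzμ
      rw [← hμ.1, mem_polar]
      intro x hx
      exact herm_comm_zero g (hcon x hx)
    have h1 := card_affine g μ z y hy hyz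
    rw [finrank_gen g hm hμ.1] at h1
    have hq : 0 < q := by have := g.one_lt; omega
    have hN : 1 ≤ N := by
      by_contra h
      have h0 : N = 0 := by omega
      have h2 := finrank_gen g hm hμ.1
      rw [h0, Submodule.finrank_eq_zero] at h2
      rw [h2, Submodule.mem_bot] at hy
      rw [hy] at hyz
      exact hyz (herm_zero_left z)
    apply Nat.eq_of_mul_eq_mul_right (m := q ^ 2) (by positivity)
    rw [← pow_succ, Nat.sub_add_cancel hN, ← h1]
    congr 1
    apply Nat.card_congr
    refine (Equiv.subtypeSubtypeEquivSubtypeInter _ (fun w => w ∈ μ)).trans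
      (Equiv.subtypeEquivRight fun w => ?_)
    constructor
    · rintro ⟨⟨-, h, -⟩, h'⟩; exact ⟨h', h⟩
    · rintro ⟨h', h⟩
      refine ⟨⟨?_, h, mem_gen g hμ.1 h' h'⟩, h'⟩
      rw [← le_polar_span g]
      exact hμ.2.1.trans (gen_le g hμ.1 h')
  · rintro ⟨w, hwZ, hwz, hww⟩
    have hwz0 : herm q w z ≠ 0 := by rw [hwz]; exact one_ne_zero
    have hzw0 : herm q z w ≠ 0 := fun h => hwz0 (herm_comm_zero g h)
    have hZw : Z ≤ polar q (F ∙ w) := (le_polar_span g).2 hwZ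
    have hnz : ∀ μ : Submodule F (Fin m → F), polar q μ = μ → w ∈ μ → z ∉ μ := by
      intro μ h1 h2 h3
      exact hwz0 (mem_gen g h1 h2 h3)
    refine Nat.card_congr
      { toFun := fun μ => ⟨mv q μ.1.1 z, (St_mv g hZ hz hzZ (hnz _ μ.1.2.1 μ.2) μ.1.2.1 μ.1.2.2.1).1 μ.1.2⟩
        invFun := fun G => ⟨⟨mv q G.1 w, ?_⟩, ?_⟩
        left_inv := ?_
        right_inv := ?_ }
    · have hwin : w ∈ mv q G.1 w := Submodule.mem_sup_right (Submodule.mem_span_singleton_self w)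
      have hpol := polar_mv g G.2.1 hww
      rw [St_mv g hZ hz hzZ (hnz _ hpol hwin) hpol]
      · rw [mv_mv g G.2.1 _ hwz0]
        · exact G.2
        · exact G.2.2.1 (Submodule.mem_sup_right (Submodule.mem_span_singleton_self z))
      · exact le_sup_of_le_left (le_inf (le_sup_left.trans G.2.2.1) hZw)
    · exact Submodule.mem_sup_right (Submodule.mem_span_singleton_self w)
    · rintro ⟨⟨μ, hμ⟩, hw⟩
      apply Subtype.ext
      apply Subtype.ext
      exact mv_mv g hμ.1 hw hzw0
    · rintro ⟨G, hG⟩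
      apply Subtype.ext
      exact mv_mv g hG.1 (hG.2.1 (Submodule.mem_sup_right (Submodule.mem_span_singleton_self z))) hwz0

theorem cSt_steps (g : Good q F) {N : ℕ} (hm : m = 2 * N) {α : Submodule F (Fin m → F)} {j k : ℕ}
    (e : ℕ) : ∀ (Z : Submodule F (Fin m → F)), Z ≤ α ⊓ polar q α →
    Module.finrank F (α ⊓ polar q α : Submodule F (Fin m → F)) = Module.finrank F Z + e →
    cSt q Z α j k * q ^ ((Module.finrank F Z + e) ^ 2)
      = q ^ (2 * N * e + (Module.finrank F Z) ^ 2) * cSt q (α ⊓ polar q α) α j k := by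
  have hq : 0 < q := by have := g.one_lt; omega
  induction e with
  | zero =>
    intro Z hZ hd
    have : Z = α ⊓ polar q α := Submodule.eq_of_le_of_finrank_eq hZ hd.symm
    rw [← this]; ring
  | succ e ih =>
    intro Z hZ hd
    have hlt : Z < α ⊓ polar q α := by
      refine lt_of_le_of_ne hZ ?_
      intro h
      rw [← h] at hd
      omega
    obtain ⟨z, hz, hzZ⟩ := SetLike.exists_of_lt hlt
    have h1 := cSt_step g hm (j := j) (k := k) hZ hz hzZ
    have h2 := ih (Z ⊔ (F ∙ z)) (sup_le hZ ((Submodule.span_singleton_le_iff_mem _ _).2 hz)) (by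
      rw [Submodule.finrank_sup_span_singleton hzZ]; omega)
    rw [Submodule.finrank_sup_span_singleton hzZ] at h2
    set d := Module.finrank F Z
    apply Nat.eq_of_mul_eq_mul_right (m := q ^ (2 * d + 1)) (by positivity)
    rw [mul_right_comm, h1, mul_assoc]
    have e1 : d + (e + 1) = d + 1 + e := by omega
    rw [e1, h2]; ring

end states


section steps
variable {q : ℕ} {F : Type} [Field F] [Fintype F] {m : ℕ}

theorem natCard_split {X : Type} [Finite X] (p r : X → Prop) (h : ∀ x, r x → p x) :
    Nat.card {x // p x ∧ ¬ r x} + Nat.card {x // r x} = Nat.card {x // p x} := by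
  have := Set.ncard_sdiff_add_ncard_of_subset (s := {x | r x}) (t := {x | p x}) h
  exact this

theorem rad_a (g : Good q F) {α : Submodule F (Fin m → F)} {a : Fin m → F} (ha : a ∈ α)
    (haa : herm q a a = 0) :
    (α ⊓ polar q (F ∙ a)) ⊓ polar q (α ⊓ polar q (F ∙ a)) = (α ⊓ polar q α) ⊔ (F ∙ a) := by
  have h1 : (F ∙ a) ≤ α ⊓ polar q (F ∙ a) :=
    le_inf ((Submodule.span_singleton_le_iff_mem _ _).2 ha) (span_le_polar g haa)
  have h2 : polar q α ≤ polar q (F ∙ a) := polar_anti ((Submodule.span_singleton_le_iff_mem _ _).2 ha)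
  rw [polar_inf g, polar_polar g, ← inf_sup_assoc_of_le _ h1, inf_assoc, inf_eq_right.2 h2]

theorem St_a (g : Good q F) {Z α : Submodule F (Fin m → F)} (hZ : Z = α ⊓ polar q α) {j : ℕ}
    {a : Fin m → F} (ha : a ∈ α) (haZ : a ∉ Z) (haa : herm q a a = 0)
    (G : Submodule F (Fin m → F)) :
    (St q Z α 1 j G ∧ a ∈ G) ↔ St q (Z ⊔ (F ∙ a)) (α ⊓ polar q (F ∙ a)) 0 j G := by
  by_cases hG : polar q G = G
  swap
  · unfold St; tauto
  by_cases hZG : Z ⊔ (F ∙ a) ≤ G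
  swap
  · constructor
    · rintro ⟨h1, h2⟩
      exact absurd (sup_le h1.2.1 ((Submodule.span_singleton_le_iff_mem _ _).2 h2)) hZG
    · intro h; exact absurd h.2.1 hZG
  have hZG1 : Z ≤ G := le_sup_left.trans hZG
  have haG : a ∈ G := (Submodule.span_singleton_le_iff_mem _ _).1 (le_sup_right.trans hZG)
  have haσ : a ∉ polar q α := fun h => haZ (by rw [hZ]; exact ⟨ha, h⟩)
  unfold St
  rw [rad_a g ha haa, ← hZ, inf_eq_right.2 hZG, inf_eq_right.2 hZG1]
  have h1 : G ⊓ (α ⊓ polar q (F ∙ a)) = G ⊓ α := by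
    rw [← inf_assoc, inf_eq_left]
    exact inf_le_left.trans (gen_le g hG haG)
  have h2 : G ⊓ polar q (α ⊓ polar q (F ∙ a)) = (G ⊓ polar q α) ⊔ (F ∙ a) := by
    rw [polar_inf g, polar_polar g,
      inf_sup_assoc_of_le _ ((Submodule.span_singleton_le_iff_mem _ _).2 haG)]
  have h3 : a ∉ G ⊓ polar q α := fun h => haσ h.2
  rw [h1, h2, Submodule.finrank_sup_span_singleton h3,
    Submodule.finrank_sup_span_singleton haZ]
  simp only [hG, hZG, hZG1, haG, true_and, and_true]
  refine and_congr (by omega) (by omega)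

theorem cSt_a (g : Good q F) {Z α : Submodule F (Fin m → F)} (hZ : Z = α ⊓ polar q α) {j t : ℕ}
    (ht : ∀ a ∈ α, a ∉ Z → herm q a a = 0 →
      cSt q (Z ⊔ (F ∙ a)) (α ⊓ polar q (F ∙ a)) 0 j = t) :
    cSt q Z α 1 j * ((q ^ 2) ^ (Module.finrank F Z + 1) - (q ^ 2) ^ (Module.finrank F Z))
      = (nv q α 0 - (q ^ 2) ^ (Module.finrank F Z)) * t := by
  have hd := dc (A := {G : Submodule F (Fin m → F) // St q Z α 1 j G})
    (B := {a : Fin m → F // (a ∈ α ∧ herm q a a = 0) ∧ a ∉ Z})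
    (fun G a => a.1 ∈ G.1) ((q ^ 2) ^ (Module.finrank F Z + 1) - (q ^ 2) ^ (Module.finrank F Z)) t ?_ ?_
  · have h1 := natCard_split (fun a : Fin m → F => a ∈ α ∧ herm q a a = 0) (fun a => a ∈ Z) (by
      intro x hx
      rw [hZ] at hx
      exact ⟨hx.1, mem_polar.1 hx.2 x hx.1⟩)
    have h2 := natCard_sub g Z
    change _ + Nat.card Z = nv q α 0 at h1
    rw [h2] at h1
    rw [← h1, Nat.add_sub_cancel]
    exact hd
  · rintro ⟨G, hG⟩
    have h1 := natCard_split (fun a : Fin m → F => a ∈ G ⊓ α) (fun a => a ∈ Z) (by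
      intro x hx
      refine ⟨hG.2.1 hx, ?_⟩
      rw [hZ] at hx
      exact hx.1)
    have h2 := natCard_sub g Z
    have h3 := natCard_sub g (G ⊓ α)
    rw [hG.2.2.2.1] at h3
    change _ + Nat.card Z = Nat.card (G ⊓ α : Submodule F (Fin m → F)) at h1
    rw [h2, h3] at h1
    rw [← h1, Nat.add_sub_cancel]
    apply Nat.card_congr
    refine (Equiv.subtypeSubtypeEquivSubtypeInter _ (fun w => w ∈ G)).trans
      (Equiv.subtypeEquivRight fun w => ?_)
    constructor
    · rintro ⟨⟨⟨h1, h2⟩, h3⟩, h4⟩; exact ⟨⟨h4, h1⟩, h3⟩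
    · rintro ⟨⟨h4, h1⟩, h3⟩; exact ⟨⟨⟨h1, mem_gen g hG.1 h4 h4⟩, h3⟩, h4⟩
  · rintro ⟨a, ⟨ha, haa⟩, haZ⟩
    rw [← ht a ha haZ haa]
    apply Nat.card_congr
    exact (Equiv.subtypeSubtypeEquivSubtypeInter _ (fun G => a ∈ G)).trans
      (Equiv.subtypeEquivRight fun G => St_a g hZ ha haZ haa G)

/-! ### unitary step -/

theorem polar_u (g : Good q F) {α : Submodule F (Fin m → F)} {v w : Fin m → F} (hv : v ∈ α)
    (hw : w ∈ polar q α) (hu : herm q (v + w) (v + w) = 0) :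
    polar q ((α ⊓ polar q (F ∙ v)) ⊔ (F ∙ (v + w)))
      = (polar q α ⊓ polar q (F ∙ w)) ⊔ (F ∙ (v + w)) := by
  rw [polar_sup g, polar_inf g, polar_polar g]
  apply le_antisymm
  · rintro x ⟨hx, hxu⟩
    obtain ⟨y, hy, z, hz, rfl⟩ := Submodule.mem_sup.1 hx
    obtain ⟨c, rfl⟩ := Submodule.mem_span_singleton.1 hz
    have e : y + c • v = (y - c • w) + c • (v + w) := by rw [smul_add]; abel
    have hy' : y - c • w ∈ polar q α := Submodule.sub_mem _ hy (Submodule.smul_mem _ _ hw)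
    have h1 := (mem_polar_span g).1 hxu
    rw [e, herm_add_left, herm_smul_left, hu, mul_zero, add_zero, herm_add_right g,
      mem_polar.1 hy' v hv, zero_add] at h1
    rw [e]
    exact Submodule.add_mem_sup ⟨hy', (mem_polar_span g).2 h1⟩
      (Submodule.smul_mem _ _ (Submodule.mem_span_singleton_self _))
  · refine sup_le ?_ ?_
    · rintro y ⟨hy, hyw⟩
      refine ⟨Submodule.mem_sup_left hy, (mem_polar_span g).2 ?_⟩
      rw [herm_add_right g, mem_polar.1 hy v hv, (mem_polar_span g).1 hyw, add_zero]
    · rw [Submodule.span_singleton_le_iff_mem]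
      refine ⟨?_, (mem_polar_span g).2 hu⟩
      rw [add_comm]
      exact Submodule.add_mem_sup hw (Submodule.mem_span_singleton_self _)

theorem rad_u (g : Good q F) {α : Submodule F (Fin m → F)} {v w : Fin m → F} (hv : v ∈ α)
    (hw : w ∈ polar q α) (hu : herm q (v + w) (v + w) = 0) (hd : herm q v v ≠ 0) :
    ((α ⊓ polar q (F ∙ v)) ⊔ (F ∙ (v + w))) ⊓ polar q ((α ⊓ polar q (F ∙ v)) ⊔ (F ∙ (v + w)))
      = (α ⊓ polar q α) ⊔ (F ∙ (v + w)) := by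
  rw [polar_u g hv hw hu]
  apply le_antisymm
  · rintro x ⟨hx1, hx2⟩
    obtain ⟨a, ⟨ha, hav⟩, s, hs, rfl⟩ := Submodule.mem_sup.1 hx1
    obtain ⟨c, rfl⟩ := Submodule.mem_span_singleton.1 hs
    obtain ⟨b, ⟨hb, hbw⟩, s, hs, he⟩ := Submodule.mem_sup.1 hx2
    obtain ⟨c', rfl⟩ := Submodule.mem_span_singleton.1 hs
    have e1 : a - (c' - c) • v = b + (c' - c) • w := by
      have : a = b + c' • (v + w) - c • (v + w) := by rw [he]; abel
      rw [this]
      simp only [smul_add, sub_smul]; abel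
    have e2 : a - (c' - c) • v ∈ polar q α := by
      rw [e1]; exact Submodule.add_mem _ hb (Submodule.smul_mem _ _ hw)
    have e3 := mem_polar.1 e2 v hv
    rw [sub_eq_add_neg, ← neg_smul, herm_add_left, herm_smul_left, (mem_polar_span g).1 hav,
      zero_add] at e3
    have e4 : c' - c = 0 := neg_eq_zero.1 ((mul_eq_zero.1 e3).resolve_right hd)
    rw [e4, zero_smul, sub_zero] at e2
    exact Submodule.add_mem_sup ⟨ha, e2⟩
      (Submodule.smul_mem _ _ (Submodule.mem_span_singleton_self _))
  · refine sup_le ?_ (le_inf le_sup_right le_sup_right)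
    rintro x ⟨h1, h2⟩
    refine ⟨Submodule.mem_sup_left ⟨h1, (mem_polar_span g).2 (mem_polar.1 h2 v hv)⟩,
      Submodule.mem_sup_left ⟨h2, (mem_polar_span g).2 ?_⟩⟩
    exact herm_comm_zero g (mem_polar.1 hw x h1)

theorem finrank_u (g : Good q F) {β G : Submodule F (Fin m → F)} {x y : Fin m → F}
    (hG : polar q G = G) (hy : y ∈ polar q β) (hx : x ∈ β)
    (hyy : herm q y y ≠ 0) (huG : x + y ∈ G) :
    Module.finrank F (G ⊓ ((β ⊓ polar q (F ∙ x)) ⊔ (F ∙ (x + y))) : Submodule F (Fin m → F))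
      = Module.finrank F (G ⊓ β : Submodule F (Fin m → F)) + 1 := by
  have h1 : G ⊓ (β ⊓ polar q (F ∙ x)) = G ⊓ β := by
    rw [← inf_assoc, inf_eq_left]
    rintro t ⟨ht1, ht2⟩
    rw [mem_polar_span g]
    have := mem_gen g hG ht1 huG
    rwa [herm_add_right g, herm_comm_zero g (mem_polar.1 hy t ht2), add_zero] at this
  rw [← inf_sup_assoc_of_le _ ((Submodule.span_singleton_le_iff_mem _ _).2 huG), h1,
    Submodule.finrank_sup_span_singleton]
  rintro ⟨-, h⟩
  have : y ∈ β := by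
    have := β.sub_mem h hx
    rwa [add_sub_cancel_left] at this
  exact hyy (mem_polar.1 hy y this)

theorem St_u (g : Good q F) {Z α : Submodule F (Fin m → F)} (hZ : Z = α ⊓ polar q α)
    {v w : Fin m → F} (hv : v ∈ α)
    (hw : w ∈ polar q α) (hu : herm q (v + w) (v + w) = 0) (hd : herm q v v ≠ 0)
    (hdw : herm q w w ≠ 0) (G : Submodule F (Fin m → F)) :
    (St q Z α 0 0 G ∧ v + w ∈ G) ↔
      St q (Z ⊔ (F ∙ (v + w))) ((α ⊓ polar q (F ∙ v)) ⊔ (F ∙ (v + w))) 0 0 G := by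
  by_cases hG : polar q G = G
  swap
  · unfold St; tauto
  by_cases hZG : Z ⊔ (F ∙ (v + w)) ≤ G
  swap
  · constructor
    · rintro ⟨h1, h2⟩
      exact absurd (sup_le h1.2.1 ((Submodule.span_singleton_le_iff_mem _ _).2 h2)) hZG
    · intro h; exact absurd h.2.1 hZG
  have hZG1 : Z ≤ G := le_sup_left.trans hZG
  have huG : v + w ∈ G := (Submodule.span_singleton_le_iff_mem _ _).1 (le_sup_right.trans hZG)
  have huZ : v + w ∉ Z := by
    rw [hZ]
    rintro ⟨-, h⟩
    have h2 : v ∈ polar q α := by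
      have := Submodule.sub_mem _ h hw
      rwa [add_sub_cancel_right] at this
    exact hd (mem_polar.1 h2 v hv)
  have h2 := finrank_u g hG (β := polar q α) (x := w) (y := v) (by rw [polar_polar g]; exact hv) hw hd
    (by rw [add_comm]; exact huG)
  rw [add_comm w v] at h2
  unfold St
  rw [rad_u g hv hw hu hd, ← hZ, inf_eq_right.2 hZG, inf_eq_right.2 hZG1, polar_u g hv hw hu, h2,
    finrank_u g hG hw hv hdw huG, Submodule.finrank_sup_span_singleton huZ]
  simp only [hG, hZG, hZG1, huG, true_and, and_true]
  refine and_congr (by omega) (by omega)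

theorem cSt_u (g : Good q F) {Z α : Submodule F (Fin m → F)} (hZ : Z = α ⊓ polar q α) {t : ℕ}
    {v : Fin m → F} (hv : v ∈ α) (hd : herm q v v ≠ 0)
    (ht : ∀ w ∈ polar q α, herm q (v + w) (v + w) = 0 → herm q w w ≠ 0 →
      cSt q (Z ⊔ (F ∙ (v + w))) ((α ⊓ polar q (F ∙ v)) ⊔ (F ∙ (v + w))) 0 0 = t) :
    cSt q Z α 0 0 * (q ^ 2) ^ (Module.finrank F Z) = nv q (polar q α) 1 * t := by
  have key : ∀ w ∈ polar q α, herm q (v + w) (v + w) = herm q v v + herm q w w := by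
    intro w hw
    have h1 := mem_polar.1 hw v hv
    rw [herm_add_left, herm_add_right g, herm_add_right g, h1, herm_comm_zero g h1]; ring
  rw [← nv_scale g _ (-herm q v v) (by rw [g.neg_pow, herm_self_fixed g]) (neg_ne_zero.2 hd)]
  refine dc (A := {G : Submodule F (Fin m → F) // St q Z α 0 0 G})
    (B := {w : Fin m → F // w ∈ polar q α ∧ herm q w w = -herm q v v})
    (fun G w => v + w.1 ∈ G.1) _ _ ?_ ?_
  · rintro ⟨G, hG⟩
    rw [← natCard_sub g]
    have hZσ : Z ≤ G ⊓ polar q α := le_inf hG.2.1 (hZ.le.trans inf_le_right)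
    have hZα : Z ≤ G ⊓ α := le_inf hG.2.1 (hZ.le.trans inf_le_left)
    have e1 : Z = G ⊓ polar q α := Submodule.eq_of_le_of_finrank_eq hZσ hG.2.2.2.2.symm
    have e2 : Z = G ⊓ α := Submodule.eq_of_le_of_finrank_eq hZα hG.2.2.2.1.symm
    have hvin : v ∈ G ⊔ polar q α := by
      have : G ⊔ polar q α = polar q Z := by rw [e2, polar_inf g, hG.1]
      rw [this, ← le_polar_span g]
      exact (hZ.le.trans inf_le_right).trans (polar_anti ((Submodule.span_singleton_le_iff_mem _ _).2 hv))
    obtain ⟨g0, hg0, y, hy, hgy⟩ := Submodule.mem_sup.1 hvin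
    apply Nat.card_congr
    refine (Equiv.subtypeSubtypeEquivSubtypeInter _ (fun w => v + w ∈ G)).trans
      ((Equiv.addRight y).subtypeEquiv fun w => ?_)
    change _ ↔ w + y ∈ Z
    have e3 : v + w = g0 + (w + y) := by rw [← hgy]; abel
    rw [e3, G.add_mem_iff_right hg0]
    constructor
    · rintro ⟨⟨h1, h2⟩, h3⟩
      rw [e1]
      exact ⟨h3, Submodule.add_mem _ h1 hy⟩
    · intro h
      rw [e1] at h
      have h1 : w ∈ polar q α := ((polar q α).add_mem_iff_left hy).1 h.2
      refine ⟨⟨h1, ?_⟩, h.1⟩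
      have h2 : v + w ∈ G := by rw [e3]; exact G.add_mem hg0 h.1
      have h3 := key w h1
      rw [mem_gen g hG.1 h2 h2] at h3
      exact eq_neg_of_add_eq_zero_right h3.symm
  · rintro ⟨w, hw, hww⟩
    have hu : herm q (v + w) (v + w) = 0 := by rw [key w hw, hww, add_neg_cancel]
    have hdw : herm q w w ≠ 0 := by rw [hww]; exact neg_ne_zero.2 hd
    rw [← ht w hw hu hdw]
    apply Nat.card_congr
    exact (Equiv.subtypeSubtypeEquivSubtypeInter _ (fun G => v + w ∈ G)).trans
      (Equiv.subtypeEquivRight fun G => St_u g hZ hv hw hu hd hdw G)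

theorem cSt_zero (g : Good q F) {N : ℕ} (hm : m = 2 * N) (k : ℕ) :
    ∀ {Z α : Submodule F (Fin m → F)}, Z = α ⊓ polar q α → Module.finrank F α = N →
    N = Module.finrank F Z + k →
    (cSt q Z α 0 0 : ℚ) = ∏ j ∈ Finset.range k, (q : ℚ) ^ j * ((q : ℚ) ^ (j + 1) - (-1) ^ (j + 1)) := by
  have hq0 : (q : ℚ) ≠ 0 := by exact_mod_cast g.ne_zero
  induction k with
  | zero =>
    intro Z α hZ hα hN
    have e1 : Z = α := Submodule.eq_of_le_of_finrank_eq (hZ.le.trans inf_le_left) (by omega)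
    have e2 : α ≤ polar q α := by rw [← inf_eq_left, ← hZ, e1]
    have e3 : α = polar q α := Submodule.eq_of_le_of_finrank_eq e2 (by rw [finrank_polar g]; omega)
    subst e1
    rw [Finset.range_zero, Finset.prod_empty]
    suffices cSt q Z Z 0 0 = 1 by rw [this]; norm_num
    unfold cSt
    rw [Nat.card_eq_one_iff_unique]
    constructor
    · constructor
      rintro ⟨G, hG⟩ ⟨G', hG'⟩
      apply Subtype.ext
      have h1 : Z = G := Submodule.eq_of_le_of_finrank_eq hG.2.1 (by rw [finrank_gen g hm hG.1, hα])
      have h2 : Z = G' := Submodule.eq_of_le_of_finrank_eq hG'.2.1 (by rw [finrank_gen g hm hG'.1, hα])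
      change G = G'
      rw [← h1, h2]
    · refine ⟨⟨Z, e3.symm, le_rfl, ?_, ?_, ?_⟩⟩
      · rw [← hZ, inf_idem]
      · rw [inf_idem]; rfl
      · rw [← hZ]; rfl
  | succ k ih =>
    intro Z α hZ hα hN
    have hZf : Module.finrank F Z = Module.finrank F (α ⊓ polar q α : Submodule F (Fin m → F)) := by
      rw [← hZ]
    obtain ⟨v, hv, hd⟩ := exists_nonisotropic g (W := α) (by rw [← hZf]; omega)
    have ih' : ∀ w ∈ polar q α, herm q (v + w) (v + w) = 0 → herm q w w ≠ 0 →
      (cSt q (Z ⊔ (F ∙ (v + w))) ((α ⊓ polar q (F ∙ v)) ⊔ (F ∙ (v + w))) 0 0 : ℚ)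
        = ∏ j ∈ Finset.range k, (q : ℚ) ^ j * ((q : ℚ) ^ (j + 1) - (-1) ^ (j + 1)) := by
      intro w hw hu hdw
      have huα : v + w ∉ α := by
        intro h
        have h2 : w ∈ α := by
          have := Submodule.sub_mem _ h hv
          rwa [add_sub_cancel_left] at this
        exact hdw (mem_polar.1 hw w h2)
      apply ih
      · rw [rad_u g hv hw hu hd, hZ]
      · have h3 : v + w ∉ α ⊓ polar q (F ∙ v) := fun h => huα h.1
        rw [Submodule.finrank_sup_span_singleton h3, finrank_inf_polar_span g hv hd, hα]
      · rw [Submodule.finrank_sup_span_singleton]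
        · omega
        · intro h; rw [hZ] at h; exact huα h.1
    have hnv := (nv_formula g (k + 1) (polar q α) (by
      rw [polar_polar g, inf_comm, ← hZ, finrank_polar g]; omega)).2
    rw [polar_polar g, inf_comm, ← hZ] at hnv
    rw [Finset.prod_range_succ]
    set T : ℚ := ∏ j ∈ Finset.range k, (q : ℚ) ^ j * ((q : ℚ) ^ (j + 1) - (-1) ^ (j + 1)) with hT
    have fin : ∀ t : ℕ, (t : ℚ) = T → cSt q Z α 0 0 * (q ^ 2) ^ (Module.finrank F Z)
        = nv q (polar q α) 1 * t → (cSt q Z α 0 0 : ℚ)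
        = T * ((q : ℚ) ^ k * ((q : ℚ) ^ (k + 1) - (-1) ^ (k + 1))) := by
      intro t ht h
      have h' := congrArg (Nat.cast : ℕ → ℚ) h
      push_cast at h'
      rw [ht] at h'
      apply mul_right_cancel₀ (b := (q : ℚ) * ((q : ℚ) ^ 2) ^ (Module.finrank F Z)) (by positivity)
      rw [mul_left_comm, h', ← mul_assoc, hnv]
      ring
    by_cases hex : ∃ w ∈ polar q α, herm q (v + w) (v + w) = 0 ∧ herm q w w ≠ 0
    · obtain ⟨w, hw, hu, hdw⟩ := hex
      refine fin _ (ih' w hw hu hdw) (cSt_u g hZ hv hd ?_)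
      intro w' hw' hu' hdw'
      have h1 := ih' w hw hu hdw
      have h2 := ih' w' hw' hu' hdw'
      exact_mod_cast h2.trans h1.symm
    · exfalso
      push Not at hex
      have h0 : nv q (polar q α) 1 = 0 := by
        rw [← nv_scale g _ (-herm q v v) (by rw [g.neg_pow, herm_self_fixed g]) (neg_ne_zero.2 hd)]
        unfold nv
        rw [Nat.card_eq_zero]
        left
        constructor
        rintro ⟨w, hw, hww⟩
        have h1 := mem_polar.1 hw v hv
        have h2 := hex w hw (by
          rw [herm_add_left, herm_add_right g, herm_add_right g, h1, herm_comm_zero g h1, hww]; ring)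
        rw [h2] at hww
        exact hd (neg_eq_zero.1 hww.symm)
      rw [h0] at hnv
      have hq2 : (1 : ℚ) < q := by exact_mod_cast g.one_lt
      have h3 : (1 : ℚ) < q ^ (k + 1) := one_lt_pow₀ hq2 (by omega)
      have h4 : (q : ℚ) ^ (2 * (k + 1)) - (-1) ^ (k + 1) * (q : ℚ) ^ (k + 1) ≠ 0 := by
        rw [mul_comm 2, pow_mul]
        rcases neg_one_pow_eq_or ℚ (k + 1) with h | h <;> rw [h] <;> nlinarith
      simp at hnv
      rcases hnv with h | h
      · exact g.ne_zero h.1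
      · exact h4 h

end steps


section count
variable {q : ℕ} {F : Type} [Field F] [Fintype F] {m : ℕ}

theorem muH_nat (q k : ℕ) : muH q (k : ℤ) =
    (((q:ℚ)^(k+1) - (-1:ℚ)^(k+1)) * ((q:ℚ)^k - (-1:ℚ)^k)) / ((q:ℚ)^2 - 1) := by
  unfold muH
  have : ((k : ℤ) + 1) = ((k + 1 : ℕ) : ℤ) := by push_cast; ring
  rw [this]
  simp only [zpow_natCast]

theorem cSt_aQ (g : Good q F) {Z α : Submodule F (Fin m → F)} (hZ : Z = α ⊓ polar q α) {j k : ℕ}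
    (hk : Module.finrank F α = Module.finrank F Z + (k + 1)) {T : ℚ}
    (hT : ∀ a ∈ α, a ∉ Z → herm q a a = 0 →
      (cSt q (Z ⊔ (F ∙ a)) (α ⊓ polar q (F ∙ a)) 0 j : ℚ) = T) :
    (cSt q Z α 1 j : ℚ) = muH q (k : ℤ) * T := by
  have hq1 : (1 : ℚ) < q := by exact_mod_cast g.one_lt
  have hq0 : (q : ℚ) ≠ 0 := by exact_mod_cast g.ne_zero
  have hnv := (nv_formula g (k + 1) α (by rw [← hZ]; exact hk)).1
  rw [← hZ] at hnv
  set z := Module.finrank F Z with hz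
  have hnv2 : (nv q α 0 : ℚ) - ((q : ℚ) ^ 2) ^ z =
      ((q : ℚ) ^ 2) ^ z * (((q:ℚ)^(k+1) - (-1:ℚ)^(k+1)) * ((q:ℚ)^k - (-1:ℚ)^k)) := by
    apply mul_left_cancel₀ hq0
    rw [mul_sub, hnv]
    have e : (-1 : ℚ) ^ k * (-1) ^ k = 1 := by rw [← mul_pow]; norm_num
    have e2 : (q : ℚ) ^ (2 * (k + 1)) = ((q : ℚ) ^ k) ^ 2 * q ^ 2 := by ring
    rw [e2, pow_succ (q : ℚ) k, pow_succ (-1 : ℚ) k]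
    linear_combination ((((q : ℚ) ^ 2) ^ z * q)) * e
  have h1k : (1 : ℚ) ≤ (q : ℚ) ^ k := one_le_pow₀ hq1.le
  have h1k1 : (1 : ℚ) ≤ (q : ℚ) ^ (k + 1) := one_le_pow₀ hq1.le
  have hge : (q ^ 2) ^ z ≤ nv q α 0 := by
    have : (((q ^ 2) ^ z : ℕ) : ℚ) ≤ nv q α 0 := by
      push_cast
      rw [← sub_nonneg, hnv2]
      refine mul_nonneg (by positivity) (mul_nonneg ?_ ?_)
      · rcases neg_one_pow_eq_or ℚ (k + 1) with h | h <;> rw [h] <;> linarith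
      · rcases neg_one_pow_eq_or ℚ k with h | h <;> rw [h] <;> linarith
    exact_mod_cast this
  have hge2 : (q ^ 2) ^ z ≤ (q ^ 2) ^ (z + 1) :=
    Nat.pow_le_pow_right (by have := g.one_lt; positivity) (by omega)
  have key : ∀ t : ℕ, (∀ a ∈ α, a ∉ Z → herm q a a = 0 →
      cSt q (Z ⊔ (F ∙ a)) (α ⊓ polar q (F ∙ a)) 0 j = t) →
      (cSt q Z α 1 j : ℚ) = muH q (k : ℤ) * t := by
    intro t ht
    have h := congrArg (Nat.cast : ℕ → ℚ) (cSt_a g hZ ht)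
    rw [← hz, Nat.cast_mul, Nat.cast_mul, Nat.cast_sub hge, Nat.cast_sub hge2] at h
    push_cast at h
    rw [hnv2] at h
    rw [muH_nat]
    have h2 : (q : ℚ) ^ 2 - 1 ≠ 0 := by nlinarith
    have h3 : ((q : ℚ) ^ 2) ^ z ≠ 0 := by positivity
    rw [div_mul_eq_mul_div, eq_div_iff h2]
    apply mul_left_cancel₀ h3
    rw [pow_succ ((q : ℚ) ^ 2) z] at h
    linear_combination h
  by_cases hex : ∃ a ∈ α, a ∉ Z ∧ herm q a a = 0
  · obtain ⟨a, ha, haZ, haa⟩ := hex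
    rw [← hT a ha haZ haa]
    apply key
    intro b hb hbZ hbb
    exact_mod_cast (hT b hb hbZ hbb).trans (hT a ha haZ haa).symm
  · push Not at hex
    have e0 := key 0 (fun a ha haZ haa => absurd haa (hex a ha haZ))
    have e1 := key 1 (fun a ha haZ haa => absurd haa (hex a ha haZ))
    push_cast at e0 e1
    have : muH q (k : ℤ) = 0 := by linarith
    rw [e0, this]; ring

theorem exists_not_perp (g : Good q F) {α : Submodule F (Fin m → F)} {a : Fin m → F}
    (ha : a ∉ polar q α) : ∃ x ∈ α, herm q x a ≠ 0 := by
  by_contra! h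
  exact ha (mem_polar.2 fun x hx => herm_comm_zero g (h x hx))

theorem cSt_one (g : Good q F) {N : ℕ} (hm : m = 2 * N) (k : ℕ)
    {Z α : Submodule F (Fin m → F)} (hZ : Z = α ⊓ polar q α) (hα : Module.finrank F α = N)
    (hN : N = Module.finrank F Z + (k + 2)) :
    (cSt q Z α 1 1 : ℚ) = muH q ((k + 1 : ℕ) : ℤ) * (muH q ((k + 1 : ℕ) : ℤ) *
      ∏ j ∈ Finset.range k, (q : ℚ) ^ j * ((q : ℚ) ^ (j + 1) - (-1) ^ (j + 1))) := by
  apply cSt_aQ g hZ (by omega)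
  intro a ha haZ haa
  have hZ' := rad_a g ha haa
  rw [← hZ] at hZ'
  have hZ'2 : Z ⊔ (F ∙ a) = polar q (α ⊓ polar q (F ∙ a)) ⊓
      polar q (polar q (α ⊓ polar q (F ∙ a))) := by
    rw [polar_polar g, inf_comm, hZ']
  have haσ : a ∉ polar q α := fun h => haZ (by rw [hZ]; exact ⟨ha, h⟩)
  obtain ⟨x, hx, hxa⟩ := exists_not_perp g haσ
  have hf1 := finrank_inf_polar_span g hx hxa
  have hfZ := Submodule.finrank_sup_span_singleton haZ
  rw [cSt_swap g]
  have hf2 := finrank_polar g (α ⊓ polar q (F ∙ a))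
  apply cSt_aQ g hZ'2 (by omega)
  intro b hb hbZ hbb
  have hbσ : b ∉ polar q (polar q (α ⊓ polar q (F ∙ a))) := fun h =>
    hbZ (by rw [hZ'2]; exact ⟨hb, h⟩)
  obtain ⟨y, hy, hyb⟩ := exists_not_perp g hbσ
  have hf3 := finrank_inf_polar_span g hy hyb
  have hfZ2 := Submodule.finrank_sup_span_singleton hbZ
  apply cSt_zero g hm k _ (by omega) (by omega)
  rw [rad_a g hb hbb, ← hZ'2]

theorem good_of {p hh : ℕ} (hp : p.Prime) (hh1 : 1 ≤ hh)
    (hq : q = p ^ hh) (hF : Fintype.card F = q ^ 2) : Good q F := by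
  have : Fact p.Prime := ⟨hp⟩
  have hc : CharP F p := by
    obtain ⟨r, hr⟩ := CharP.exists F
    obtain ⟨n, hr1, hn⟩ := FiniteField.card F r
    have h1 : r ∣ p ^ (hh * 2) := by
      rw [pow_mul, ← hq, ← hF, hn]
      exact dvd_pow_self _ n.ne_zero
    rw [(Nat.prime_dvd_prime_iff_eq hr1 hp).1 (hr1.dvd_of_dvd_pow h1)] at hr
    exact hr
  refine ⟨hF, ?_, ?_⟩
  · intro x y
    rw [hq]
    exact add_pow_char_pow x y p hh
  · rw [hq]; exact Nat.one_lt_pow (by omega) hp.one_lt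

theorem isGen_iff (g : Good q F) {n : ℕ} (G : Submodule F (Fin (2 * n + 2) → F)) :
    IsGenerator q n G ↔ polar q G = G := by
  unfold IsGenerator
  rw [isotropic_iff g]
  have h := finrank_polar g G
  constructor
  · rintro ⟨h1, h2⟩
    exact (Submodule.eq_of_le_of_finrank_eq h2 (by omega)).symm
  · intro h1
    exact ⟨finrank_gen g (N := n + 1) (by ring) h1, h1.ge⟩

end count

set_option linter.unusedSectionVars false

section start
variable {q : ℕ} {F : Type} [Field F] [Fintype F] {m : ℕ}

theorem exists_unique_pt {V : Type} [AddCommGroup V] [Module F V] (A R : Submodule F V)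
    [FiniteDimensional F V] :
    (∃! L : Submodule F V, Module.finrank F L = 1 ∧ L ≤ A ∧ ¬ L ≤ R) ↔
      Module.finrank F A = 1 ∧ A ⊓ R = ⊥ := by
  have span1 : ∀ b : V, b ∉ R → Module.finrank F (F ∙ b) = 1 := by
    intro b hb
    apply finrank_span_singleton
    rintro rfl
    exact hb R.zero_mem
  constructor
  · rintro ⟨L, ⟨hL1, hLA, hLR⟩, huniq⟩
    obtain ⟨a, haL, haR⟩ := SetLike.not_le_iff_exists.1 hLR
    have hsp : ∀ b ∈ A, b ∉ R → (F ∙ b) = L := by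
      intro b hbA hbR
      apply huniq
      refine ⟨span1 b hbR, (Submodule.span_singleton_le_iff_mem _ _).2 hbA, fun h => hbR ?_⟩
      exact (Submodule.span_singleton_le_iff_mem _ _).1 h
    have hbL : ∀ b ∈ A, b ∉ R → b ∈ L := by
      intro b hbA hbR
      rw [← hsp b hbA hbR]
      exact Submodule.mem_span_singleton_self b
    have hbot : A ⊓ R = ⊥ := by
      rw [eq_bot_iff]
      rintro r ⟨hrA, hrR⟩
      rw [Submodule.mem_bot]
      by_contra hr0
      have h1 : a + r ∈ L := hbL _ (A.add_mem (hLA haL) hrA) (fun h => haR (by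
        have := R.sub_mem h hrR
        rwa [add_sub_cancel_right] at this))
      have h2 : r ∈ L := by
        have := L.sub_mem h1 haL
        rwa [add_sub_cancel_left] at this
      have h3 : (F ∙ r) = L := by
        apply Submodule.eq_of_le_of_finrank_eq ((Submodule.span_singleton_le_iff_mem _ _).2 h2)
        rw [hL1, finrank_span_singleton hr0]
      exact hLR (h3 ▸ (Submodule.span_singleton_le_iff_mem _ _).2 hrR)
    refine ⟨?_, hbot⟩
    have : A = L := by
      refine le_antisymm (fun b hb => ?_) hLA
      by_cases hbR : b ∈ R
      · have : b ∈ A ⊓ R := ⟨hb, hbR⟩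
        rw [hbot, Submodule.mem_bot] at this
        rw [this]; exact L.zero_mem
      · exact hbL b hb hbR
    rw [this, hL1]
  · rintro ⟨h1, h2⟩
    refine ⟨A, ⟨h1, le_rfl, fun h => ?_⟩, ?_⟩
    · rw [inf_eq_left.2 h] at h2
      rw [h2, finrank_bot] at h1
      omega
    · rintro L ⟨hL1, hLA, -⟩
      exact Submodule.eq_of_le_of_finrank_eq hLA (by rw [hL1, h1])

theorem polar_alpha1 (g : Good q F) (π : Submodule F (Fin m → F)) {v : Fin m → F}
    (hv : herm q v v = 0) :
    polar q ((π ⊓ polar q (F ∙ v)) ⊔ (F ∙ v)) = (polar q π ⊓ polar q (F ∙ v)) ⊔ (F ∙ v) := by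
  have h : (F ∙ v) ≤ polar q (F ∙ v) := by
    rw [le_polar_span g, mem_polar_span g]; exact hv
  rw [polar_sup g, polar_inf g, polar_polar g, sup_comm (polar q π), sup_inf_assoc_of_le _ h,
    sup_comm]

theorem rad_alpha1 (π : Submodule F (Fin m → F)) {v : Fin m → F}
    (hspan : v ∉ π ⊔ polar q π) :
    ((π ⊓ polar q (F ∙ v)) ⊔ (F ∙ v)) ⊓ ((polar q π ⊓ polar q (F ∙ v)) ⊔ (F ∙ v))
      = ((π ⊓ polar q π) ⊓ polar q (F ∙ v)) ⊔ (F ∙ v) := by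
  apply le_antisymm
  · rintro x ⟨h1, h2⟩
    obtain ⟨u, hu, y, hy, rfl⟩ := Submodule.mem_sup.1 h1
    obtain ⟨w, hw, z, hz, hwz⟩ := Submodule.mem_sup.1 h2
    obtain ⟨c, rfl⟩ := Submodule.mem_span_singleton.1 hy
    obtain ⟨d, rfl⟩ := Submodule.mem_span_singleton.1 hz
    have h3 : (d - c) • v ∈ π ⊔ polar q π := by
      have : (d - c) • v = u - w := by
        rw [sub_smul, sub_eq_sub_iff_add_eq_add, add_comm, hwz]
      rw [this]
      exact Submodule.sub_mem _ (Submodule.mem_sup_left hu.1) (Submodule.mem_sup_right hw.1)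
    have h4 : d - c = 0 := by
      by_contra h
      exact hspan ((Submodule.smul_mem_iff _ h).1 h3)
    have h5 : d = c := sub_eq_zero.1 h4
    subst h5
    have h6 : w = u := add_right_cancel hwz
    subst h6
    exact Submodule.mem_sup.2 ⟨w, ⟨⟨hu.1, hw.1⟩, hu.2⟩, _, hy, rfl⟩
  · refine sup_le (le_inf ?_ ?_) (le_inf le_sup_right le_sup_right)
    · exact le_sup_of_le_left (inf_le_inf_right _ inf_le_left)
    · exact le_sup_of_le_left (inf_le_inf_right _ inf_le_right)

theorem finrank_gen_inf (g : Good q F) {G A : Submodule F (Fin m → F)} (hG : polar q G = G)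
    {v : Fin m → F} (hv : v ∈ G) (hvA : v ∉ A) :
    Module.finrank F (G ⊓ ((A ⊓ polar q (F ∙ v)) ⊔ (F ∙ v)) : Submodule F (Fin m → F))
      = Module.finrank F (G ⊓ A : Submodule F (Fin m → F)) + 1 := by
  have h : G ⊓ ((A ⊓ polar q (F ∙ v)) ⊔ (F ∙ v)) = (G ⊓ A) ⊔ (F ∙ v) := by
    rw [← inf_sup_assoc_of_le _ ((Submodule.span_singleton_le_iff_mem _ _).2 hv), ← inf_assoc]
    congr 1
    rw [inf_eq_left]
    exact inf_le_left.trans (gen_le g hG hv)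
  rw [h]
  have h3 : v ∉ G ⊓ A := fun h => hvA h.2
  exact Submodule.finrank_sup_span_singleton h3

theorem card_eq_cSt (g : Good q F) {n : ℕ} (π : Submodule F (Fin (2 * n + 2) → F))
    {v : Fin (2 * n + 2) → F} (hv : herm q v v = 0) (hspan : v ∉ π ⊔ polar q π) :
    Nat.card {μ : Submodule F (Fin (2*n+2) → F) //
        IsGenerator q n μ ∧ (F ∙ v) ≤ μ ∧
        (∃! R : Submodule F (Fin (2*n+2) → F),
          Module.finrank F R = 1 ∧ R ≤ μ ⊓ π ∧ ¬ R ≤ π ⊓ polar q π) ∧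
        (∃! R : Submodule F (Fin (2*n+2) → F),
          Module.finrank F R = 1 ∧ R ≤ μ ⊓ polar q π ∧ ¬ R ≤ π ⊓ polar q π)}
      = cSt q (F ∙ v) ((π ⊓ polar q (F ∙ v)) ⊔ (F ∙ v)) 1 1 := by
  have hv0 : v ≠ 0 := by rintro rfl; exact hspan (Submodule.zero_mem _)
  apply Nat.card_congr
  refine Equiv.subtypeEquivRight fun G => ?_
  unfold St
  rw [isGen_iff g]
  refine and_congr_right fun hG => and_congr_right fun hvG => ?_
  have hvG' := (Submodule.span_singleton_le_iff_mem _ _).1 hvG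
  have hvR : v ∉ π ⊓ polar q π := fun h => hspan (Submodule.mem_sup_left h.1)
  rw [exists_unique_pt, exists_unique_pt, polar_alpha1 g π hv, rad_alpha1 π hspan,
    finrank_gen_inf g hG hvG' (fun h => hspan (Submodule.mem_sup_left h)),
    finrank_gen_inf g hG hvG' (fun h => hspan (Submodule.mem_sup_right h)),
    finrank_gen_inf g hG hvG' hvR,
    finrank_span_singleton hv0]
  have e1 : (G ⊓ π) ⊓ (π ⊓ polar q π) = G ⊓ (π ⊓ polar q π) := by
    rw [inf_assoc, ← inf_assoc π π, inf_idem]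
  have e2 : (G ⊓ polar q π) ⊓ (π ⊓ polar q π) = G ⊓ (π ⊓ polar q π) := by
    rw [inf_assoc, inf_comm π, ← inf_assoc (polar q π) (polar q π), inf_idem]
  rw [e1, e2, ← Submodule.finrank_eq_zero (R := F) (S := G ⊓ (π ⊓ polar q π))]
  omega

theorem final_arith (g : Good q F) (i k : ℕ) (c M : ℚ)
    (h : c * (q : ℚ) ^ ((1 + i) ^ 2) = (q : ℚ) ^ (2 * (i + k + 3) * i + 1 ^ 2) * (M * (M *
      ∏ j ∈ Finset.range k, (q : ℚ) ^ j * ((q : ℚ) ^ (j + 1) - (-1) ^ (j + 1))))) :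
    c = NN q (i + k + 1) ((i : ℤ) - 1) * (q : ℚ) ^ (4 * (i : ℤ)) * M ^ 2 := by
  have hq0 : (q : ℚ) ≠ 0 := by exact_mod_cast g.ne_zero
  unfold NN
  have e1 : (((i + k + 1 : ℕ) : ℤ) - ((i : ℤ) - 1) - 1).toNat = k + 1 := by omega
  have e2 : (((i + k + 1 : ℕ) : ℤ) - ((i : ℤ) - 1) - 2).toNat = k := by omega
  rw [e1, e2]
  rw [Finset.prod_mul_distrib, Finset.prod_pow_eq_pow_sum, Finset.sum_range_id] at h
  set Q := ∏ j ∈ Finset.range k, ((q : ℚ) ^ (j + 1) - (-1) ^ (j + 1)) with hQ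
  rw [← Nat.choose_two_right] at h
  have hC : (2 * (k.choose 2 : ℤ)) = k * (k - 1) := by
    have h1 := Nat.choose_two_right k
    have h2 := Nat.div_mul_cancel (Nat.even_mul_pred_self k).two_dvd
    rw [← h1] at h2
    rcases k with _ | k
    · simp
    · rw [Nat.add_sub_cancel] at h2
      have h3 := congrArg (Nat.cast : ℕ → ℤ) h2
      push_cast at h3 ⊢
      linarith
  have hC1 : ((k + 1).choose 2 : ℤ) = k.choose 2 + k := by
    rw [Nat.choose_succ_succ' k 1]; push_cast; simp; ring
  rw [hC1]
  have e3 : (q : ℚ) ^ ((((i + k + 1 : ℕ) : ℤ) - 1) ^ 2 - ((k.choose 2 : ℤ) + k)) * (q : ℚ) ^ (4 * (i : ℤ))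
      * (q : ℚ) ^ ((1 + i) ^ 2) = (q : ℚ) ^ (2 * (i + k + 3) * i + 1 ^ 2) * (q : ℚ) ^ (k.choose 2) := by
    simp only [← zpow_natCast]
    rw [← zpow_add₀ hq0, ← zpow_add₀ hq0, ← zpow_add₀ hq0]
    congr 1
    push_cast
    linear_combination (-1 : ℤ) * hC
  apply mul_right_cancel₀ (b := (q : ℚ) ^ ((1 + i) ^ 2)) (by positivity)
  rw [h]
  linear_combination (-(Q * M ^ 2)) * e3

end start

/-- Number of generators through a point `P ∉ ⟨π, π^σ⟩` meeting each of
`π \\ πᵢ` and `π^σ \\ πᵢ` in exactly one point. -/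
theorem stmt9 (n q p hh : ℕ) (hn : 2 ≤ n) (hp : p.Prime) (hh1 : 1 ≤ hh)
    (hq : q = p ^ hh)
    (F : Type) [Field F] [Fintype F] (hF : Fintype.card F = q ^ 2)
    (i : ℤ) (hi1 : 0 ≤ i) (hi2 : i ≤ (n:ℤ) - 2)
    (π : Submodule F (Fin (2*n+2) → F)) (hπ : Module.finrank F π = n + 1)
    (hdim : (Module.finrank F ↥(π ⊓ polar q π) : ℤ) = i + 1)
    (P : Submodule F (Fin (2*n+2) → F)) (hP : IsHermPoint q P)
    (hPπ : ¬ P ≤ π) (hPσ : ¬ P ≤ polar q π)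
    (hPspan : ¬ P ≤ π ⊔ polar q π) :
    (Nat.card {μ : Submodule F (Fin (2*n+2) → F) //
        IsGenerator q n μ ∧ P ≤ μ ∧
        (∃! R : Submodule F (Fin (2*n+2) → F),
          Module.finrank F R = 1 ∧ R ≤ μ ⊓ π ∧ ¬ R ≤ π ⊓ polar q π) ∧
        (∃! R : Submodule F (Fin (2*n+2) → F),
          Module.finrank F R = 1 ∧ R ≤ μ ⊓ polar q π ∧ ¬ R ≤ π ⊓ polar q π)} : ℚ)
      = NN q (n-1) (i-1) * (q:ℚ)^(4*i) * (muH q ((n:ℤ)-i-1))^2 := by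
  have g : Good q F := good_of hp hh1 hq hF
  obtain ⟨hP1, hP2⟩ := hP
  obtain ⟨v, hvP, hv0, rfl⟩ : ∃ v ∈ P, v ≠ 0 ∧ P = F ∙ v := by
    obtain ⟨v, hvP, hv⟩ := SetLike.not_le_iff_exists.1 hPπ
    have hv0 : v ≠ 0 := by rintro rfl; exact hv π.zero_mem
    refine ⟨v, hvP, hv0, (Submodule.eq_of_le_of_finrank_eq
      ((Submodule.span_singleton_le_iff_mem _ _).2 hvP) ?_).symm⟩
    rw [hP1, finrank_span_singleton hv0]
  have hv : herm q v v = 0 := hP2 v hvP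
  have hspan : v ∉ π ⊔ polar q π := fun h =>
    hPspan ((Submodule.span_singleton_le_iff_mem _ _).2 h)
  rw [card_eq_cSt g π hv hspan]
  have hm : 2 * n + 2 = 2 * (n + 1) := by ring
  lift i to ℕ using hi1
  obtain ⟨k, rfl⟩ : ∃ k, n = i + k + 2 := ⟨n - i - 2, by omega⟩
  have hR : v ∉ polar q (π ⊓ polar q π) := by
    rw [polar_inf g, polar_polar g, sup_comm]; exact hspan
  obtain ⟨x, hx, hxv⟩ := exists_not_perp g hR
  have f1 := finrank_inf_polar_span g hx hxv
  have f2 := finrank_inf_polar_span g hx.1 hxv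
  have v1 : v ∉ π ⊓ polar q (F ∙ v) := fun h => hspan (Submodule.mem_sup_left h.1)
  have v2 : v ∉ (π ⊓ polar q π) ⊓ polar q (F ∙ v) := fun h => hspan (Submodule.mem_sup_left h.1.1)
  have f3 := Submodule.finrank_sup_span_singleton v1
  have f4 := Submodule.finrank_sup_span_singleton v2
  set α := (π ⊓ polar q (F ∙ v)) ⊔ (F ∙ v) with hα
  have hrad : α ⊓ polar q α = ((π ⊓ polar q π) ⊓ polar q (F ∙ v)) ⊔ (F ∙ v) := by
    rw [hα, polar_alpha1 g π hv, rad_alpha1 π hspan]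
  rw [← hrad] at f4
  have st := cSt_steps g hm (α := α) (j := 1) (k := 1) i (F ∙ v)
    (by rw [hrad]; exact le_sup_right) (by rw [hP1]; omega)
  have one := cSt_one g hm k (Z := α ⊓ polar q α) (α := α) rfl (by omega) (by omega)
  rw [hP1] at st
  have st' := congrArg (Nat.cast : ℕ → ℚ) st
  push_cast at st'
  rw [one] at st'
  have e1 : i + k + 2 - 1 = i + k + 1 := by omega
  have e2 : ((i + k + 2 : ℕ) : ℤ) - (i : ℤ) - 1 = ((k + 1 : ℕ) : ℤ) := by push_cast; ring
  rw [e1, e2]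
  exact final_arith g i k _ _ st'

end HermCode
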